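/- arXiv:1905.04731 — 5 statements merged into one kernel-verified Lean document; each statement's English description precedes it below -/
import Mathlib

section
/- Let R be a commutative Noetherian local ring and M a finitely generated R-module. If M has finite reducing Gorenstein dimension and Ext^i_R(M,R) = 0 for all i ≥ 1, then M is totally reflexive. -/
open CategoryTheory

universe u

variable (R : Type u) [CommRing R]

/-- `SES R A B C` : there is a short exact sequence `0 → A → B → C → 0` of `R`-modules. -/
def SES (A B C : ModuleCat.{u} R) : Prop :=
  ∃ (f : A →ₗ[R] B) (g : B →ₗ[R] C),
    Function.Injective f ∧ Function.Surjective g ∧ LinearMap.range f = LinearMap.ker g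

/-- A finitely generated free module. -/
def IsFinFree (F : ModuleCat.{u} R) : Prop :=
  Module.Finite R F ∧ Module.Free R F

/-- `IsSyzygy R n S K` : `S` is an `n`-th syzygy of `K`, i.e. there is an exact sequence
`0 → S → F_{n-1} → ⋯ → F_0 → K → 0` with each `F_j` finitely generated free
(for `n = 0` this just means `S ≅ K`). -/
def IsSyzygy : ℕ → ModuleCat.{u} R → ModuleCat.{u} R → Prop
  | 0, S, K => Nonempty (S ≃ₗ[R] K)
  | n + 1, S, K => ∃ T F : ModuleCat.{u} R, IsSyzygy n T K ∧ IsFinFree R F ∧ SES R S F T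

/-- The direct sum `M^{⊕ a}`. -/
def MPow (M : ModuleCat.{u} R) (a : ℕ) : ModuleCat.{u} R := ModuleCat.of R (Fin a → M)

/-- `IsReducingSeq R K` : the finitely generated modules `K 0, …, K r` form a reducing
sequence, i.e. there are positive integers `a i, b i, n i` and short exact sequences
`0 → (K i)^{⊕ a i} → K (i+1) → S i → 0` where `S i` is an `(n i)`-th syzygy
of `(K i)^{⊕ b i}`. -/
def IsReducingSeq {r : ℕ} (K : Fin (r + 1) → ModuleCat.{u} R) : Prop :=
  (∀ i, Module.Finite R (K i)) ∧
  ∃ a b n : Fin r → ℕ,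
    (∀ i, 0 < a i) ∧ (∀ i, 0 < b i) ∧ (∀ i, 0 < n i) ∧
    ∀ i : Fin r, ∃ S : ModuleCat.{u} R,
      IsSyzygy R (n i) S (MPow R (K i.castSucc) (b i)) ∧
      SES R (MPow R (K i.castSucc) (a i)) (K i.succ) S

/-- `ExtVanishes R M N i` : the `R`-module `Ext^i_R(M, N)` is zero. -/
def ExtVanishes (M N : ModuleCat.{u} R) (i : ℕ) : Prop :=
  Subsingleton (((Ext R (ModuleCat.{u} R) i).obj (Opposite.op M)).obj N)

/-- A totally reflexive module. -/
def IsTotallyReflexive (M : ModuleCat.{u} R) : Prop :=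
  Function.Bijective (Module.Dual.eval R M) ∧
  ∀ i : ℕ, 1 ≤ i →
    ExtVanishes R M (ModuleCat.of R R) i ∧
    ExtVanishes R (ModuleCat.of R (Module.Dual R M)) (ModuleCat.of R R) i

/-- `ResolvedBy R P m M` : there is an exact sequence `0 → G_m → ⋯ → G_0 → M → 0`
in which each `G_j` satisfies `P`. -/
def ResolvedBy (P : ModuleCat.{u} R → Prop) : ℕ → ModuleCat.{u} R → Prop
  | 0, M => ∃ G : ModuleCat.{u} R, P G ∧ Nonempty (G ≃ₗ[R] M)
  | m + 1, M => ∃ G S : ModuleCat.{u} R, P G ∧ SES R S G M ∧ ResolvedBy P m S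

/-- Finite Gorenstein dimension. -/
def FiniteGdim (M : ModuleCat.{u} R) : Prop :=
  ∃ m : ℕ, ResolvedBy R (IsTotallyReflexive R) m M

/-- Finite projective dimension. -/
def FinitePd (M : ModuleCat.{u} R) : Prop :=
  ∃ m : ℕ, ResolvedBy R (fun G => Module.Projective R G) m M

/-- `HasRedSeqTo R P M` : `M` admits a reducing sequence `K_0 = M, K_1, …, K_r`
whose last module `K_r` satisfies `P`. -/
def HasRedSeqTo (P : ModuleCat.{u} R → Prop) (M : ModuleCat.{u} R) : Prop :=
  ∃ (r : ℕ) (K : Fin (r + 1) → ModuleCat.{u} R),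
    K 0 = M ∧ IsReducingSeq R K ∧ P (K (Fin.last r))

/-- Finite reducing Gorenstein dimension. -/
def FiniteRedGdim (M : ModuleCat.{u} R) : Prop :=
  HasRedSeqTo R (FiniteGdim R) M

/-- Finite reducing projective dimension. -/
def FiniteRedPd (M : ModuleCat.{u} R) : Prop :=
  HasRedSeqTo R (FinitePd R) M

section Aux
open CategoryTheory.Limits

/-- vanishing of `Ext^i(A, R)` -/
def VExt (A : Type u) [AddCommGroup A] [Module R A] (i : ℕ) : Prop :=
  Subsingleton (Abelian.Ext.{u} (ModuleCat.of R A) (ModuleCat.of R R) i)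

theorem extVanishes_iff (M N : ModuleCat.{u} R) (n : ℕ) :
    ExtVanishes R M N (n + 1) ↔ Subsingleton (Abelian.Ext.{u} M N (n + 1)) := by
  let P : ProjectiveResolution M := ProjectiveResolution.of M
  have key : ExtVanishes R M N (n + 1) ↔
      ∀ f : P.complex.X (n + 1) ⟶ N, P.complex.d (n + 2) (n + 1) ≫ f = 0 →
        ∃ g : P.complex.X n ⟶ N, P.complex.d (n + 1) n ≫ g = f := by
    unfold ExtVanishes
    rw [← ModuleCat.isZero_iff_subsingleton, (P.isoExt (n + 1) N).isZero_iff,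
      ← HomologicalComplex.exactAt_iff_isZero_homology,
      HomologicalComplex.exactAt_iff' _ n (n + 1) (n + 2) (by simp) (by simp),
      ShortComplex.moduleCat_exact_iff]
    exact Iff.rfl
  rw [key]
  constructor
  · intro h
    refine subsingleton_of_forall_eq 0 fun α => ?_
    obtain ⟨f, hf, rfl⟩ := P.extMk_surjective α (n + 2) rfl
    rw [P.extMk_eq_zero_iff f _ rfl hf n rfl]
    exact h f hf
  · intro h f hf
    exact (P.extMk_eq_zero_iff f _ rfl hf n rfl).1 (Subsingleton.elim _ _)

variable {R}
variable {A B C : Type u} [AddCommGroup A] [Module R A] [AddCommGroup B] [Module R B]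
  [AddCommGroup C] [Module R C]

theorem VExt.iff {i : ℕ} (hi : 1 ≤ i) :
    ExtVanishes R (ModuleCat.of R A) (ModuleCat.of R R) i ↔ VExt R A i := by
  obtain ⟨n, rfl⟩ : ∃ n, i = n + 1 := ⟨i - 1, by omega⟩
  exact extVanishes_iff R _ _ n

/-- unbundled short exact sequences -/
structure IsSES (f : A →ₗ[R] B) (g : B →ₗ[R] C) : Prop where
  inj : Function.Injective f
  ex : Function.Exact f g
  surj : Function.Surjective g

theorem VExt.retract {i : ℕ} (s : A →ₗ[R] B) (r : B →ₗ[R] A) (h : r ∘ₗ s = LinearMap.id)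
    (hB : VExt R B i) : VExt R A i := by
  refine subsingleton_of_forall_eq 0 fun α => ?_
  have h1 : ModuleCat.ofHom s ≫ ModuleCat.ofHom r = 𝟙 _ := by
    rw [← ModuleCat.ofHom_comp, h]; rfl
  have h2 := Abelian.Ext.mk₀_comp_mk₀_assoc (ModuleCat.ofHom s) (ModuleCat.ofHom r) α
  rw [h1, Abelian.Ext.mk₀_id_comp] at h2
  have : Subsingleton (Abelian.Ext.{u} (ModuleCat.of R B) (ModuleCat.of R R) i) := hB
  rw [← h2, Subsingleton.elim ((Abelian.Ext.mk₀ (ModuleCat.ofHom r)).comp α _) 0]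
  simp

/-- the bundled short complex -/
noncomputable def IsSES.sc {f : A →ₗ[R] B} {g : B →ₗ[R] C} (h : IsSES f g) :
    ShortComplex (ModuleCat.{u} R) :=
  ShortComplex.mk (ModuleCat.ofHom f) (ModuleCat.ofHom g) (by
    ext x; exact h.ex.apply_apply_eq_zero x)

theorem IsSES.se {f : A →ₗ[R] B} {g : B →ₗ[R] C} (h : IsSES f g) : h.sc.ShortExact where
  exact := (ShortComplex.ShortExact.moduleCat_exact_iff_function_exact _).2 h.ex
  mono_f := (ModuleCat.mono_iff_injective _).2 h.inj
  epi_g := (ModuleCat.epi_iff_surjective _).2 h.surj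

section
variable {f : A →ₗ[R] B} {g : B →ₗ[R] C}

theorem IsSES.left (h : IsSES f g) {i : ℕ} (hB : VExt R B i) (hC : VExt R C (i + 1)) : VExt R A i := by
  refine subsingleton_of_forall_eq 0 fun α => ?_
  have : Subsingleton (Abelian.Ext.{u} (ModuleCat.of R B) (ModuleCat.of R R) i) := hB
  have : Subsingleton (Abelian.Ext.{u} h.sc.X₃ (ModuleCat.of R R) (i + 1)) := hC
  obtain ⟨x, rfl⟩ := Abelian.Ext.contravariant_sequence_exact₁ h.se _ α (n₁ := i + 1) (by omega)
    (Subsingleton.elim _ _)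
  rw [show x = 0 from Subsingleton.elim (α := Abelian.Ext.{u} (ModuleCat.of R B) (ModuleCat.of R R) i) _ _]
  simp only [Abelian.Ext.comp_zero]; rfl

theorem IsSES.mid (h : IsSES f g) {i : ℕ} (hA : VExt R A i) (hC : VExt R C i) : VExt R B i := by
  refine subsingleton_of_forall_eq 0 fun α => ?_
  have : Subsingleton (Abelian.Ext.{u} h.sc.X₁ (ModuleCat.of R R) i) := hA
  obtain ⟨x, rfl⟩ := Abelian.Ext.contravariant_sequence_exact₂ h.se _ α
    (Subsingleton.elim _ _)
  have : Subsingleton (Abelian.Ext.{u} h.sc.X₃ (ModuleCat.of R R) i) := hC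
  rw [show x = 0 from Subsingleton.elim _ _]
  simp only [Abelian.Ext.comp_zero]; rfl

theorem IsSES.right (h : IsSES f g) {i : ℕ} (hA : VExt R A i) (hB : VExt R B (i + 1)) : VExt R C (i + 1) := by
  refine subsingleton_of_forall_eq 0 fun α => ?_
  have : Subsingleton (Abelian.Ext.{u} h.sc.X₂ (ModuleCat.of R R) (i + 1)) := hB
  obtain ⟨x, rfl⟩ := Abelian.Ext.contravariant_sequence_exact₃ h.se _ α
    (Subsingleton.elim _ _) (n₀ := i) (by omega)
  have : Subsingleton (Abelian.Ext.{u} h.sc.X₁ (ModuleCat.of R R) i) := hA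
  rw [show x = 0 from Subsingleton.elim _ _]
  simp only [Abelian.Ext.comp_zero]; rfl

theorem IsSES.dual_surj (h : IsSES f g) (hC : VExt R C 1) : Function.Surjective f.dualMap := by
  intro φ
  have : Subsingleton (Abelian.Ext.{u} h.sc.X₃ (ModuleCat.of R R) 1) := hC
  obtain ⟨x, hx⟩ := Abelian.Ext.contravariant_sequence_exact₁ h.se _
    (Abelian.Ext.mk₀ (ModuleCat.ofHom φ : h.sc.X₁ ⟶ ModuleCat.of R R)) (n₁ := 1) (by omega)
    (Subsingleton.elim _ _)
  obtain ⟨y, rfl⟩ := (Abelian.Ext.mk₀_bijective _ _).2 x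
  rw [Abelian.Ext.mk₀_comp_mk₀] at hx
  have := (Abelian.Ext.mk₀_bijective _ _).1 hx
  refine ⟨y.hom, ?_⟩
  exact congrArg ModuleCat.Hom.hom this

theorem IsSES.right_one (h : IsSES f g) (hs : Function.Surjective f.dualMap) (hB : VExt R B 1) : VExt R C 1 := by
  refine subsingleton_of_forall_eq 0 fun α => ?_
  have : Subsingleton (Abelian.Ext.{u} h.sc.X₂ (ModuleCat.of R R) 1) := hB
  obtain ⟨x, rfl⟩ := Abelian.Ext.contravariant_sequence_exact₃ h.se _ α
    (Subsingleton.elim _ _) (n₀ := 0) (by omega)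
  obtain ⟨y, rfl⟩ := (Abelian.Ext.mk₀_bijective _ _).2 x
  obtain ⟨φ, hφ⟩ := hs y.hom
  obtain ⟨ψ, rfl⟩ : ∃ ψ : h.sc.X₂ ⟶ ModuleCat.of R R, y = h.sc.f ≫ ψ := by
    refine ⟨ModuleCat.ofHom φ, ?_⟩
    apply ModuleCat.hom_ext; exact hφ.symm
  rw [← Abelian.Ext.mk₀_comp_mk₀]
  exact h.se.extClass_comp_assoc _

theorem IsSES.dual_ex (h : IsSES f g) : Function.Exact g.dualMap f.dualMap := by
    intro φ
    constructor
    · intro hφ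
      have hk : LinearMap.ker g ≤ LinearMap.ker φ := by
        intro x hx
        obtain ⟨a, rfl⟩ := (h.ex x).1 hx
        exact LinearMap.congr_fun hφ a
      refine ⟨((LinearMap.ker g).liftQ φ hk) ∘ₗ
        (g.quotKerEquivOfSurjective h.surj).symm.toLinearMap, ?_⟩
      ext x
      have : (g.quotKerEquivOfSurjective h.surj).symm (g x) = (LinearMap.ker g).mkQ x := by
        rw [LinearEquiv.symm_apply_eq]; rfl
      simp [this]
    · rintro ⟨ψ, rfl⟩
      ext a
      simp [h.ex.apply_apply_eq_zero]

theorem IsSES.dual (h : IsSES f g) (hC : VExt R C 1) : IsSES g.dualMap f.dualMap where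
  inj := LinearMap.dualMap_injective_of_surjective h.surj
  surj := h.dual_surj hC
  ex := h.dual_ex

end

variable (R) in
/-- reflexivity together with vanishing of `Ext^i(A,R)`, and of `Ext^i(A*,R)` for `i ≤ m` -/
structure QRefl (A : Type u) [AddCommGroup A] [Module R A] (m : ℕ) : Prop where
  refl : Function.Bijective (Module.Dual.eval R A)
  ext : ∀ i, 1 ≤ i → VExt R A i
  dext : ∀ i, 1 ≤ i → i ≤ m → VExt R (Module.Dual R A) i

theorem eval_nat (f : A →ₗ[R] B) (a : A) :
    Module.Dual.eval R B (f a) = f.dualMap.dualMap (Module.Dual.eval R A a) := rfl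

section
variable {f : A →ₗ[R] B} {g : B →ₗ[R] C}

theorem IsSES.refl_left (h : IsSES f g) (hB : Function.Bijective (Module.Dual.eval R B))
    (hC : Function.Injective (Module.Dual.eval R C)) (hC1 : VExt R C 1) :
    Function.Bijective (Module.Dual.eval R A) := by
  have D := h.dual hC1
  have hf := LinearMap.dualMap_injective_of_surjective D.surj
  constructor
  · intro x y hxy
    apply h.inj
    apply hB.1
    rw [eval_nat, eval_nat, hxy]
  · intro α
    obtain ⟨b, hb⟩ := hB.2 (f.dualMap.dualMap α)
    have h1 : Module.Dual.eval R C (g b) = 0 := by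
      rw [eval_nat, hb]; exact (D.dual_ex _).2 ⟨α, rfl⟩
    have h2 : g b = 0 := hC (by rw [h1, map_zero])
    obtain ⟨a, rfl⟩ := (h.ex b).1 h2
    exact ⟨a, hf (by rw [← eval_nat, hb])⟩

theorem IsSES.refl_right (h : IsSES f g) (hA : Function.Bijective (Module.Dual.eval R A))
    (hB : Function.Bijective (Module.Dual.eval R B)) (hC1 : VExt R C 1)
    (hA1 : VExt R (Module.Dual R A) 1) :
    Function.Bijective (Module.Dual.eval R C) := by
  have D := h.dual hC1
  constructor
  · rw [injective_iff_map_eq_zero]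
    intro c hc
    obtain ⟨b, rfl⟩ := h.surj c
    rw [eval_nat] at hc
    obtain ⟨α, hα⟩ := (D.dual_ex _).1 hc
    obtain ⟨a, rfl⟩ := hA.2 α
    rw [← eval_nat] at hα
    rw [← hB.1 hα]
    exact h.ex.apply_apply_eq_zero a
  · intro γ
    obtain ⟨β, rfl⟩ := D.dual_surj hA1 γ
    obtain ⟨b, rfl⟩ := hB.2 β
    exact ⟨g b, rfl⟩

theorem IsSES.refl_mid (h : IsSES f g) (hA : Function.Bijective (Module.Dual.eval R A))
    (hC : Function.Bijective (Module.Dual.eval R C)) (hC1 : VExt R C 1) :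
    Function.Bijective (Module.Dual.eval R B) := by
  have D := h.dual hC1
  have hf := LinearMap.dualMap_injective_of_surjective D.surj
  constructor
  · rw [injective_iff_map_eq_zero]
    intro b hb
    have h1 : g b = 0 := hC.1 (by rw [eval_nat, hb, map_zero, map_zero])
    obtain ⟨a, rfl⟩ := (h.ex b).1 h1
    have h2 : a = 0 := hA.1 (hf (by rw [← eval_nat, hb, map_zero, map_zero]))
    rw [h2, map_zero]
  · intro β
    obtain ⟨c, hc⟩ := hC.2 (g.dualMap.dualMap β)
    obtain ⟨b, rfl⟩ := h.surj c
    have h1 : g.dualMap.dualMap (β - Module.Dual.eval R B b) = 0 := by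
      rw [map_sub, ← eval_nat, hc, sub_self]
    obtain ⟨α, hα⟩ := (D.dual_ex _).1 h1
    obtain ⟨a, rfl⟩ := hA.2 α
    rw [← eval_nat] at hα
    exact ⟨f a + b, by rw [map_add, hα, sub_add_cancel]⟩

theorem IsSES.q_left (h : IsSES f g) {m : ℕ} (hB : ∀ k, QRefl R B k) (hC : QRefl R C m) : QRefl R A (m + 1) := by
  have hC1 := hC.ext 1 le_rfl
  have D := h.dual hC1
  refine ⟨h.refl_left (hB 0).refl hC.refl.1 hC1, fun i hi => ?_, fun i hi him => ?_⟩
  · exact h.left ((hB 0).ext i hi) (hC.ext _ (by omega))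
  · obtain ⟨j, rfl⟩ : ∃ j, i = j + 1 := ⟨i - 1, by omega⟩
    have hb := (hB (j + 1)).dext (j + 1) hi le_rfl
    rcases Nat.eq_zero_or_pos j with rfl | hj
    · refine D.right_one (fun γ => ?_) hb
      obtain ⟨c, rfl⟩ := hC.refl.2 γ
      obtain ⟨b, rfl⟩ := h.surj c
      exact ⟨Module.Dual.eval R B b, rfl⟩
    · exact D.right (hC.dext j hj (by omega)) hb

theorem IsSES.q_mid (h : IsSES f g) {m : ℕ} (hA : QRefl R A m) (hC : QRefl R C m) : QRefl R B m := by
  have hC1 := hC.ext 1 le_rfl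
  have D := h.dual hC1
  exact ⟨h.refl_mid hA.refl hC.refl hC1, fun i hi => h.mid (hA.ext i hi) (hC.ext i hi),
    fun i hi him => D.mid (hC.dext i hi him) (hA.dext i hi him)⟩

theorem IsSES.q_right (h : IsSES f g) (hA : ∀ k, QRefl R A k) (hB : ∀ k, QRefl R B k)
    (hC : ∀ i, 1 ≤ i → VExt R C i) (k : ℕ) : QRefl R C k := by
  have hC1 := hC 1 le_rfl
  have D := h.dual hC1
  exact ⟨h.refl_right (hA 0).refl (hB 0).refl hC1 ((hA 1).dext 1 le_rfl le_rfl), hC,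
    fun i hi _ => D.left ((hB i).dext i hi le_rfl) ((hA (i + 1)).dext (i + 1) (by omega) le_rfl)⟩

end

theorem refl_retract (s : A →ₗ[R] B) (r : B →ₗ[R] A) (h : r ∘ₗ s = LinearMap.id)
    (hB : Function.Bijective (Module.Dual.eval R B)) :
    Function.Bijective (Module.Dual.eval R A) := by
  have hrs : ∀ a, r (s a) = a := fun a => LinearMap.congr_fun h a
  constructor
  · intro x y hxy
    have : s x = s y := hB.1 (by rw [eval_nat, eval_nat, hxy])
    rw [← hrs x, this, hrs]
  · intro α
    obtain ⟨b, hb⟩ := hB.2 (s.dualMap.dualMap α)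
    refine ⟨r b, ?_⟩
    rw [eval_nat, hb]
    ext φ
    simp only [LinearMap.dualMap_apply]
    congr 1
    ext a
    simp [hrs]

theorem QRefl.retract {m : ℕ} (s : A →ₗ[R] B) (r : B →ₗ[R] A) (h : r ∘ₗ s = LinearMap.id)
    (hB : QRefl R B m) : QRefl R A m :=
  ⟨refl_retract s r h hB.refl, fun i hi => VExt.retract s r h (hB.ext i hi),
    fun i hi him => VExt.retract r.dualMap s.dualMap
      (by rw [LinearMap.dualMap_comp_dualMap, h]; rfl) (hB.dext i hi him)⟩

theorem VExt.of_projective [Module.Projective R A] {i : ℕ} (hi : 1 ≤ i) : VExt R A i := by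
  obtain ⟨n, rfl⟩ : ∃ n, i = n + 1 := ⟨i - 1, by omega⟩
  exact Abelian.Ext.subsingleton_of_projective _ _ n

theorem QRefl.of_finFree [Module.Finite R A] [Module.Free R A] (m : ℕ) : QRefl R A m :=
  ⟨Module.bijective_dual_eval R A, fun _ hi => VExt.of_projective hi,
    fun _ hi _ => VExt.of_projective hi⟩

theorem pow_ses (A : Type u) [AddCommGroup A] [Module R A] (a : ℕ) :
    IsSES (LinearMap.single R (fun _ : Fin (a + 1) => A) 0)
      (LinearMap.funLeft R A (Fin.succ : Fin a → Fin (a + 1))) where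
  inj := LinearMap.ker_eq_bot.1 (LinearMap.ker_single R (fun _ : Fin (a + 1) => A) 0)
  ex := by
    intro x
    constructor
    · intro hx
      refine ⟨x 0, ?_⟩
      ext i
      refine Fin.cases ?_ (fun j => ?_) i
      · simp
      · have := congrFun hx j
        simpa [LinearMap.funLeft_apply, Fin.succ_ne_zero] using this.symm
    · rintro ⟨y, rfl⟩
      ext j
      simp [LinearMap.funLeft_apply, Fin.succ_ne_zero]
  surj := LinearMap.funLeft_surjective_of_injective R A _ (Fin.succ_injective a)

theorem VExt.pow {i : ℕ} (hA : VExt R A i) (a : ℕ) : VExt R (Fin a → A) i := by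
  induction a with
  | zero => exact VExt.retract (0 : (Fin 0 → A) →ₗ[R] A) 0 (Subsingleton.elim _ _) hA
  | succ a ih => exact (pow_ses A a).mid hA ih

theorem QRefl.pow {m : ℕ} (hA : QRefl R A m) (a : ℕ) : QRefl R (Fin a → A) m := by
  induction a with
  | zero => exact QRefl.retract (0 : (Fin 0 → A) →ₗ[R] A) 0 (Subsingleton.elim _ _) hA
  | succ a ih => exact (pow_ses A a).q_mid hA ih

theorem QRefl.of_pow {m a : ℕ} (ha : 0 < a) (hA : QRefl R (Fin a → A) m) : QRefl R A m :=
  QRefl.retract (LinearMap.single R (fun _ : Fin a => A) ⟨0, ha⟩) (LinearMap.proj ⟨0, ha⟩)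
    (by ext; simp) hA

theorem totRefl_iff (M : ModuleCat.{u} R) : IsTotallyReflexive R M ↔ ∀ m, QRefl R M m := by
  constructor
  · intro h m
    exact ⟨h.1, fun i hi => (VExt.iff hi).1 (h.2 i hi).1,
      fun i hi _ => (VExt.iff hi).1 (h.2 i hi).2⟩
  · intro h
    exact ⟨(h 0).refl, fun i hi => ⟨(VExt.iff hi).2 ((h 0).ext i hi),
      (VExt.iff hi).2 ((h i).dext i hi le_rfl)⟩⟩

theorem SES.isSES {X Y Z : ModuleCat.{u} R} (h : SES R X Y Z) :
    ∃ (f : X →ₗ[R] Y) (g : Y →ₗ[R] Z), IsSES f g := by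
  obtain ⟨f, g, hf, hg, he⟩ := h
  exact ⟨f, g, hf, LinearMap.exact_iff.2 he.symm, hg⟩

theorem gdim_step (m : ℕ) : ∀ (M : ModuleCat.{u} R),
    ResolvedBy R (IsTotallyReflexive R) m M → (∀ i, 1 ≤ i → VExt R M i) →
    ∀ k, QRefl R M k := by
  induction m with
  | zero =>
    rintro M ⟨G, hG, ⟨e⟩⟩ _ k
    exact QRefl.retract e.symm.toLinearMap e.toLinearMap (by ext; simp) ((totRefl_iff G).1 hG k)
  | succ m ih =>
    rintro M ⟨G, S, hG, hS, hres⟩ hM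
    obtain ⟨f, g, h⟩ := hS.isSES
    have hG' := (totRefl_iff G).1 hG
    have hSq := ih S hres (fun i hi => h.left ((hG' 0).ext i hi) (hM _ (by omega)))
    exact h.q_right hSq hG' hM

theorem syz_ext (n : ℕ) : ∀ (S K : ModuleCat.{u} R), IsSyzygy R n S K →
    (∀ i, 1 ≤ i → VExt R K i) → ∀ i, 1 ≤ i → VExt R S i := by
  induction n with
  | zero =>
    rintro S K ⟨e⟩ hK i hi
    exact VExt.retract e.toLinearMap e.symm.toLinearMap (by ext; simp) (hK i hi)
  | succ n ih =>
    rintro S K ⟨T, F, hT, ⟨_, _⟩, hS⟩ hK i hi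
    obtain ⟨f, g, h⟩ := hS.isSES
    exact h.left (VExt.of_projective hi) (ih T K hT hK _ (by omega))

theorem syz_q (n : ℕ) : ∀ (S K : ModuleCat.{u} R) (m : ℕ), IsSyzygy R n S K →
    QRefl R K m → QRefl R S (m + n) := by
  induction n with
  | zero =>
    rintro S K m ⟨e⟩ hK
    exact QRefl.retract e.toLinearMap e.symm.toLinearMap (by ext; simp) hK
  | succ n ih =>
    rintro S K m ⟨T, F, hT, ⟨_, _⟩, hS⟩ hK
    obtain ⟨f, g, h⟩ := hS.isSES
    exact h.q_left (fun k => QRefl.of_finFree k) (ih T K m hT hK)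

theorem syz_torsionless (n : ℕ) (S K : ModuleCat.{u} R) (h : IsSyzygy R (n + 1) S K) :
    Function.Injective (Module.Dual.eval R S) := by
  obtain ⟨T, F, hT, ⟨_, _⟩, hS⟩ := h
  obtain ⟨f, g, h⟩ := hS.isSES
  intro x y hxy
  apply h.inj
  apply (Module.bijective_dual_eval R F).1
  rw [eval_nat, eval_nat, hxy]

theorem QRefl.mono {m k : ℕ} (h : QRefl R A m) (hk : k ≤ m) : QRefl R A k :=
  ⟨h.refl, h.ext, fun i hi hik => h.dext i hi (hik.trans hk)⟩

theorem back_step (K K' S : ModuleCat.{u} R) (a b n : ℕ) (ha : 0 < a) (hn : 0 < n)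
    (hsyz : IsSyzygy R n S (MPow R K b)) (hses : SES R (MPow R K a) K' S)
    (hK : ∀ i, 1 ≤ i → VExt R K i) (hK' : ∀ m, QRefl R K' m) (m : ℕ) : QRefl R K m := by
  obtain ⟨f, g, h⟩ := hses.isSES
  have hS : ∀ i, 1 ≤ i → VExt R S i :=
    syz_ext n S _ hsyz (fun i hi => VExt.pow (hK i hi) b)
  induction m with
  | zero =>
    obtain ⟨n, rfl⟩ : ∃ j, n = j + 1 := ⟨n - 1, by omega⟩
    have h1 := h.refl_left (hK' 0).refl (syz_torsionless n S _ hsyz) (hS 1 le_rfl)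
    exact QRefl.of_pow ha ⟨h1, fun i hi => VExt.pow (hK i hi) a, fun i hi hi0 => by omega⟩
  | succ m ih =>
    have hSq := (syz_q n S _ m hsyz (QRefl.pow ih b)).mono (Nat.le_add_right m n)
    exact QRefl.of_pow ha (h.q_left hK' hSq)

end Aux

theorem totally_reflexive_of_finiteRedGdim_of_ext_vanishing
    (R : Type u) [CommRing R] [IsNoetherianRing R] [IsLocalRing R]
    (M : ModuleCat.{u} R) (hM : Module.Finite R M)
    (hred : FiniteRedGdim R M)
    (hext : ∀ i : ℕ, 1 ≤ i → ExtVanishes R M (ModuleCat.of R R) i) :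
    IsTotallyReflexive R M := by
  obtain ⟨r, K, rfl, ⟨_, a, b, n, ha, hb, hn, hK⟩, m, hm⟩ := hred
  have hE : ∀ j : Fin (r + 1), ∀ i, 1 ≤ i → VExt R (K j) i := by
    intro j
    induction j using Fin.induction with
    | zero => exact fun i hi => (VExt.iff hi).1 (hext i hi)
    | succ j ih =>
      obtain ⟨S, hS, hses⟩ := hK j
      obtain ⟨f, g, h⟩ := hses.isSES
      exact fun i hi => h.mid (VExt.pow (ih i hi) (a j))
        (syz_ext _ S _ hS (fun i hi => VExt.pow (ih i hi) (b j)) i hi)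
  have hQ : ∀ j : Fin (r + 1), ∀ k, QRefl R (K j) k := by
    intro j
    induction j using Fin.reverseInduction with
    | last => exact gdim_step m _ hm (hE _)
    | cast j ih =>
      obtain ⟨S, hS, hses⟩ := hK j
      exact back_step _ _ S _ _ _ (ha j) (hn j) hS hses (hE _) ih
  exact (totRefl_iff _).2 (hQ 0)
end

section
/- Let R be a commutative Noetherian local ring, M a finitely generated R-module, and p ≥ 0 an integer. If M has finite reducing Gorenstein dimension and Ext^i_R(M,R) = 0 for all i > p, then there is an exact sequence 0 → G_p → ⋯ → G_1 → G_0 → M → 0 of R-modules in which each G_j is totally reflexive; in particular M has finite Gorenstein dimension. -/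
open CategoryTheory

universe u

variable (R : Type u) [CommRing R]

namespace GRed

open CategoryTheory.Abelian

/-- Vanishing of the (derived category) group `Ext^i(M, R)`. -/
def V (M : Type u) [AddCommGroup M] [Module R M] (i : ℕ) : Prop :=
  Subsingleton (Abelian.Ext.{u} (ModuleCat.of R M) (ModuleCat.of R R) i)

variable {R}

theorem subsingleton_ext_iff {X Y : ModuleCat.{u} R} (P : ProjectiveResolution X) (p : ℕ) :
    Subsingleton (Abelian.Ext.{u} X Y (p + 1)) ↔
      ∀ f : P.complex.X (p + 1) ⟶ Y, P.complex.d (p + 2) (p + 1) ≫ f = 0 →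
        ∃ g : P.complex.X p ⟶ Y, P.complex.d (p + 1) p ≫ g = f := by
  constructor
  · intro h f hf
    exact (P.extMk_eq_zero_iff f (p + 2) rfl hf p rfl).1 (Subsingleton.elim _ _)
  · intro h
    refine subsingleton_of_forall_eq 0 fun α => ?_
    obtain ⟨f, hf, rfl⟩ := P.extMk_surjective α (p + 2) rfl
    exact (P.extMk_eq_zero_iff f (p + 2) rfl hf p rfl).2 (h f hf)

theorem extVanishes_iff (X Y : ModuleCat.{u} R) (p : ℕ) :
    ExtVanishes R X Y (p + 1) ↔ Subsingleton (Abelian.Ext.{u} X Y (p + 1)) := by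
  let P : ProjectiveResolution X := ProjectiveResolution.of X
  rw [subsingleton_ext_iff P, ExtVanishes, ← ModuleCat.isZero_iff_subsingleton,
    (P.isoExt (R := R) (p + 1) Y).isZero_iff,
    ← HomologicalComplex.exactAt_iff_isZero_homology,
    HomologicalComplex.exactAt_iff' _ p (p + 1) (p + 2) (by simp) (by simp),
    ShortComplex.moduleCat_exact_iff]
  constructor
  · intro h f hf
    exact h f hf
  · intro h f hf
    exact h f hf

theorem extVanishes_iff_V (X : ModuleCat.{u} R) (i : ℕ) (hi : 1 ≤ i) :
    ExtVanishes R X (ModuleCat.of R R) i ↔ V R X i := by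
  obtain ⟨p, rfl⟩ := Nat.exists_eq_add_of_le' hi
  exact extVanishes_iff X _ p

section les
variable {A B C : Type u} [AddCommGroup A] [AddCommGroup B] [AddCommGroup C]
  [Module R A] [Module R B] [Module R C]

/-- Short exactness of a pair of linear maps. -/
structure Sx (f : A →ₗ[R] B) (g : B →ₗ[R] C) : Prop where
  inj : Function.Injective f
  surj : Function.Surjective g
  ex : Function.Exact f g

/-- The associated short complex. -/
noncomputable abbrev Sx.sc {f : A →ₗ[R] B} {g : B →ₗ[R] C} (h : Sx f g) :
    ShortComplex (ModuleCat.{u} R) :=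
  ShortComplex.mk (ModuleCat.ofHom f) (ModuleCat.ofHom g)
    (by ext x; exact (h.ex _).2 ⟨x, rfl⟩)

theorem Sx.se {f : A →ₗ[R] B} {g : B →ₗ[R] C} (h : Sx f g) : h.sc.ShortExact where
  exact := by
    rw [ShortComplex.moduleCat_exact_iff]
    intro x hx
    exact (h.ex x).1 hx
  mono_f := (ModuleCat.mono_iff_injective _).2 h.inj
  epi_g := (ModuleCat.epi_iff_surjective _).2 h.surj

variable {f : A →ₗ[R] B} {g : B →ₗ[R] C}

theorem Sx.V2 (h : Sx f g) {i : ℕ} (h1 : V R A i) (h3 : V R C i) : V R B i := by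
  refine subsingleton_of_forall_eq 0 fun x => ?_
  obtain ⟨y, rfl⟩ := Abelian.Ext.contravariant_sequence_exact₂ h.se (ModuleCat.of R R) x
    (h1.elim _ _)
  rw [show y = 0 from h3.elim _ _]
  simp

theorem Sx.V1 (h : Sx f g) {i : ℕ} (h2 : V R B i) (h3 : V R C (i + 1)) : V R A i := by
  refine subsingleton_of_forall_eq 0 fun x => ?_
  obtain ⟨y, rfl⟩ := Abelian.Ext.contravariant_sequence_exact₁ h.se (ModuleCat.of R R) x (add_comm 1 i)
    (h3.elim _ _)
  rw [show y = 0 from h2.elim _ _]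
  simp

theorem Sx.V3 (h : Sx f g) {i : ℕ} (h1 : V R A i) (h2 : V R B (i + 1)) : V R C (i + 1) := by
  refine subsingleton_of_forall_eq 0 fun x => ?_
  obtain ⟨y, rfl⟩ := Abelian.Ext.contravariant_sequence_exact₃ h.se (ModuleCat.of R R) x
    (h2.elim _ _) (add_comm 1 i)
  rw [show y = 0 from h1.elim _ _]
  simp

theorem Sx.ext_of_V (h : Sx f g) (h3 : V R C 1) : Function.Surjective f.dualMap := by
  intro φ
  obtain ⟨y, hy⟩ := Abelian.Ext.contravariant_sequence_exact₁ h.se (ModuleCat.of R R)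
    (Abelian.Ext.mk₀ (ModuleCat.ofHom φ : ModuleCat.of R A ⟶ ModuleCat.of R R)) (add_comm 1 0)
    (h3.elim _ _)
  obtain ⟨z, rfl⟩ := (Abelian.Ext.mk₀_bijective _ _).2 y
  rw [Abelian.Ext.mk₀_comp_mk₀] at hy
  have := (Abelian.Ext.mk₀_bijective _ _).1 hy
  refine ⟨z.hom, ?_⟩
  have h2 := congrArg ModuleCat.Hom.hom this
  exact h2

theorem Sx.V3_one (h : Sx f g) (h2 : V R B 1) (hs : Function.Surjective f.dualMap) :
    V R C 1 := by
  refine subsingleton_of_forall_eq 0 fun x => ?_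
  obtain ⟨y, rfl⟩ := Abelian.Ext.contravariant_sequence_exact₃ h.se (ModuleCat.of R R) x
    (h2.elim _ _) (add_comm 1 0)
  obtain ⟨z, rfl⟩ := (Abelian.Ext.mk₀_bijective _ _).2 y
  obtain ⟨w, hw⟩ := hs z.hom
  have : z = ModuleCat.ofHom f ≫ ModuleCat.ofHom w := by
    ext x
    exact (LinearMap.congr_fun hw x).symm
  rw [this, ← Abelian.Ext.mk₀_comp_mk₀, h.se.extClass_comp_assoc]

end les

theorem V_of_sum {A B C : Type u} [AddCommGroup A] [AddCommGroup B] [AddCommGroup C]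
    [Module R A] [Module R B] [Module R C] (s : A →ₗ[R] C) (r : C →ₗ[R] A)
    (s' : B →ₗ[R] C) (r' : C →ₗ[R] B) (hid : ∀ x, s (r x) + s' (r' x) = x)
    {i : ℕ} (hA : V R A i) (hB : V R B i) : V R C i := by
  refine subsingleton_of_forall_eq 0 fun x => ?_
  have h1 : (𝟙 (ModuleCat.of R C)) = ModuleCat.ofHom r ≫ ModuleCat.ofHom s +
      ModuleCat.ofHom r' ≫ ModuleCat.ofHom s' := by
    ext x
    exact (hid x).symm
  rw [← Abelian.Ext.mk₀_id_comp x, h1, Abelian.Ext.mk₀_add, Abelian.Ext.add_comp,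
    ← Abelian.Ext.mk₀_comp_mk₀_assoc, ← Abelian.Ext.mk₀_comp_mk₀_assoc,
    show (Abelian.Ext.mk₀ (ModuleCat.ofHom s)).comp x (zero_add i) = 0 from hA.elim _ _,
    show (Abelian.Ext.mk₀ (ModuleCat.ofHom s')).comp x (zero_add i) = 0 from hB.elim _ _]
  simp

theorem V_of_projective (A : Type u) [AddCommGroup A] [Module R A] [Module.Projective R A]
    {i : ℕ} (hi : 1 ≤ i) : V R A i := by
  obtain ⟨p, rfl⟩ := Nat.exists_eq_add_of_le' hi
  have : Projective (ModuleCat.of R A) := (IsProjective.iff_projective (R := R) A).1 inferInstance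
  exact Abelian.Ext.subsingleton_of_projective (ModuleCat.of R A) (ModuleCat.of R R) p

section refl
variable {A B C : Type u} [AddCommGroup A] [AddCommGroup B] [AddCommGroup C]
  [Module R A] [Module R B] [Module R C]

variable {f : A →ₗ[R] B} {g : B →ₗ[R] C}

theorem Sx.dual (h : Sx f g) (h3 : V R C 1) : Sx g.dualMap f.dualMap where
  inj := LinearMap.dualMap_injective_of_surjective h.surj
  surj := h.ext_of_V h3
  ex := by
    intro φ
    constructor
    · intro hφ
      have hk : LinearMap.ker g ≤ LinearMap.ker φ := by
        intro x hx
        obtain ⟨a, rfl⟩ := (h.ex x).1 hx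
        exact LinearMap.congr_fun hφ a
      obtain ⟨σ, hσ⟩ := h.surj.hasRightInverse
      refine ⟨(LinearMap.ker g).liftQ φ hk ∘ₗ
        (g.quotKerEquivOfSurjective h.surj).symm.toLinearMap, ?_⟩
      ext b
      have : (g.quotKerEquivOfSurjective h.surj).symm (g b) = (LinearMap.ker g).mkQ b := by
        rw [LinearEquiv.symm_apply_eq]
        simp
      simp [this]
    · rintro ⟨ψ, rfl⟩
      ext a
      have : g (f a) = 0 := (h.ex _).2 ⟨a, rfl⟩
      simp [this]

theorem eval_nat (f : A →ₗ[R] B) (a : A) :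
    f.dualMap.dualMap (Module.Dual.eval R A a) = Module.Dual.eval R B (f a) := rfl

theorem eval_inj_of_inj (hf : Function.Injective f)
    (hB : Function.Injective (Module.Dual.eval R B)) :
    Function.Injective (Module.Dual.eval R A) := by
  intro x y hxy
  apply hf
  apply hB
  rw [← eval_nat, ← eval_nat, hxy]

theorem Sx.refl_left (h : Sx f g) (h3 : V R C 1)
    (hB : Function.Bijective (Module.Dual.eval R B))
    (hC : Function.Injective (Module.Dual.eval R C)) :
    Function.Bijective (Module.Dual.eval R A) := by
  refine ⟨eval_inj_of_inj h.inj hB.1, fun φ => ?_⟩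
  have hd := h.dual h3
  obtain ⟨b, hb⟩ := hB.2 (f.dualMap.dualMap φ)
  have hgb : g b = 0 := by
    apply hC
    rw [← eval_nat, hb, map_zero]
    ext ψ
    have : f.dualMap (g.dualMap ψ) = 0 := (hd.ex _).2 ⟨ψ, rfl⟩
    simp [this]
  obtain ⟨a, rfl⟩ := (h.ex b).1 hgb
  refine ⟨a, ?_⟩
  apply LinearMap.dualMap_injective_of_surjective hd.surj
  rw [eval_nat, hb]

theorem refl_of_sum (s : A →ₗ[R] C) (r : C →ₗ[R] A)
    (s' : B →ₗ[R] C) (r' : C →ₗ[R] B) (hid : ∀ x, s (r x) + s' (r' x) = x)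
    (hA : Function.Bijective (Module.Dual.eval R A))
    (hB : Function.Bijective (Module.Dual.eval R B)) :
    Function.Bijective (Module.Dual.eval R C) := by
  constructor
  · rw [injective_iff_map_eq_zero]
    intro x hx
    have h1 : r x = 0 := hA.1 (by rw [← eval_nat, hx, map_zero, map_zero])
    have h2 : r' x = 0 := hB.1 (by rw [← eval_nat, hx, map_zero, map_zero])
    rw [← hid x, h1, h2]
    simp
  · intro φ
    obtain ⟨a, ha⟩ := hA.2 (r.dualMap.dualMap φ)
    obtain ⟨b, hb⟩ := hB.2 (r'.dualMap.dualMap φ)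
    refine ⟨s a + s' b, ?_⟩
    rw [map_add, ← eval_nat, ← eval_nat, ha, hb]
    ext ψ
    simp only [LinearMap.add_apply, LinearMap.dualMap_apply, ← map_add]
    congr 1
    ext x
    simp [← map_add, hid]

variable (R) in
/-- The approximations of total reflexivity. -/
structure Q (j : ℕ) (A : Type u) [AddCommGroup A] [Module R A] : Prop where
  refl : Function.Bijective (Module.Dual.eval R A)
  v : ∀ i, 1 ≤ i → V R A i
  vd : ∀ i, 1 ≤ i → i ≤ j → V R (Module.Dual R A) i

theorem Q.mono {j k : ℕ} (h : Q R k A) (hjk : j ≤ k) : Q R j A :=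
  ⟨h.refl, h.v, fun i hi hij => h.vd i hi (hij.trans hjk)⟩

variable (R) in
/-- Total reflexivity, unbundled. -/
def TR (A : Type u) [AddCommGroup A] [Module R A] : Prop := ∀ j, Q R j A

theorem TR_iff (X : ModuleCat.{u} R) : IsTotallyReflexive R X ↔ TR R X := by
  constructor
  · rintro ⟨h1, h2⟩ j
    exact ⟨h1, fun i hi => (extVanishes_iff_V X i hi).1 (h2 i hi).1,
      fun i hi _ => (extVanishes_iff_V (ModuleCat.of R (Module.Dual R X)) i hi).1 (h2 i hi).2⟩
  · intro h
    exact ⟨(h 0).refl, fun i hi => ⟨(extVanishes_iff_V X i hi).2 ((h 0).v i hi),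
      (extVanishes_iff_V (ModuleCat.of R (Module.Dual R X)) i hi).2 ((h i).vd i hi le_rfl)⟩⟩

theorem Q.of_sum {j : ℕ} (s : A →ₗ[R] C) (r : C →ₗ[R] A)
    (s' : B →ₗ[R] C) (r' : C →ₗ[R] B) (hid : ∀ x, s (r x) + s' (r' x) = x)
    (hA : Q R j A) (hB : Q R j B) : Q R j C where
  refl := refl_of_sum s r s' r' hid hA.refl hB.refl
  v := fun i hi => V_of_sum s r s' r' hid (hA.v i hi) (hB.v i hi)
  vd := fun i hi hij => V_of_sum r.dualMap s.dualMap r'.dualMap s'.dualMap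
    (by intro φ; ext x; simp [← map_add, hid]) (hA.vd i hi hij) (hB.vd i hi hij)

theorem Q.retract {j : ℕ} (s : A →ₗ[R] C) (r : C →ₗ[R] A) (hid : ∀ x, s (r x) = x)
    (hA : Q R j A) : Q R j C :=
  Q.of_sum s r (0 : A →ₗ[R] C) (0 : C →ₗ[R] A) (by simpa using hid) hA hA

theorem V_retract {i : ℕ} (s : A →ₗ[R] C) (r : C →ₗ[R] A) (hid : ∀ x, s (r x) = x)
    (hA : V R A i) : V R C i :=
  V_of_sum s r (0 : A →ₗ[R] C) (0 : C →ₗ[R] A) (by simpa using hid) hA hA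

theorem TR.equiv (hA : TR R A) (e : A ≃ₗ[R] C) : TR R C :=
  fun j => (hA j).retract e.toLinearMap e.symm.toLinearMap (by simp)

theorem TR.prod (hA : TR R A) (hB : TR R B) : TR R (A × B) :=
  fun j => Q.of_sum (LinearMap.inl R A B) (LinearMap.fst R A B) (LinearMap.inr R A B)
    (LinearMap.snd R A B) (by simp) (hA j) (hB j)

theorem V_pow {i : ℕ} (hA : V R A i) (n : ℕ) : V R (Fin n → A) i := by
  induction n with
  | zero => exact V_retract (0 : A →ₗ[R] _) 0 (fun x => Subsingleton.elim _ _) hA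
  | succ n ih =>
    exact V_retract (A := A × (Fin n → A))
      (Fin.consLinearEquiv R (fun _ : Fin (n + 1) => A)).toLinearMap
      (Fin.consLinearEquiv R (fun _ : Fin (n + 1) => A)).symm.toLinearMap
      (LinearEquiv.apply_symm_apply _)
      (V_of_sum (LinearMap.inl R A _) (LinearMap.fst R A _) (LinearMap.inr R A _)
        (LinearMap.snd R A _) (by simp) hA ih)

theorem Q.pow {j : ℕ} (hA : Q R j A) (n : ℕ) : Q R j (Fin n → A) := by
  induction n with
  | zero => exact Q.retract (0 : A →ₗ[R] _) 0 (fun x => Subsingleton.elim _ _) hA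
  | succ n ih =>
    exact Q.retract (A := A × (Fin n → A))
      (Fin.consLinearEquiv R (fun _ : Fin (n + 1) => A)).toLinearMap
      (Fin.consLinearEquiv R (fun _ : Fin (n + 1) => A)).symm.toLinearMap
      (LinearEquiv.apply_symm_apply _)
      (Q.of_sum (LinearMap.inl R A _) (LinearMap.fst R A _) (LinearMap.inr R A _)
        (LinearMap.snd R A _) (by simp) hA ih)

theorem Q.of_pow {j n : ℕ} (hn : 0 < n) (h : Q R j (Fin n → A)) : Q R j A :=
  Q.retract (LinearMap.proj (R := R) (φ := fun _ : Fin n => A) ⟨0, hn⟩)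
    (LinearMap.pi fun _ => LinearMap.id) (by simp) h

theorem TR.of_projective [Module.Finite R A] [Module.Projective R A] : TR R A := fun _ =>
  ⟨Module.bijective_dual_eval R A, fun _ hi => V_of_projective A hi,
    fun _ hi _ => V_of_projective _ hi⟩

theorem Sx.Q_left (h : Sx f g) {j : ℕ} (hB : TR R B) (hC : Q R j C) : Q R (j + 1) A := by
  have hd := h.dual (hC.v 1 le_rfl)
  refine ⟨h.refl_left (hC.v 1 le_rfl) (hB 0).refl hC.refl.1,
    fun i hi => h.V1 ((hB 0).v i hi) (hC.v _ (by lia)), fun i hi hij => ?_⟩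
  obtain ⟨k, rfl⟩ := Nat.exists_eq_add_of_le' hi
  rcases Nat.eq_zero_or_pos k with rfl | hk
  · refine hd.V3_one ((hB 1).vd 1 le_rfl le_rfl) fun ψ => ?_
    obtain ⟨c, rfl⟩ := hC.refl.2 ψ
    obtain ⟨b, rfl⟩ := h.surj c
    exact ⟨_, eval_nat g b⟩
  · exact hd.V3 (hC.vd k hk (by lia)) ((hB (k + 1)).vd _ (by lia) le_rfl)

theorem Sx.TR_left (h : Sx f g) (hB : TR R B) (hC : TR R C) : TR R A :=
  fun j => (h.Q_left hB (hC j)).mono (by lia)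

theorem Sx.TR_right (h : Sx f g) (hA : TR R A) (hB : TR R B) (h3 : V R C 1) : TR R C := by
  have hd := h.dual h3
  have hdd := hd.dual ((hA 1).vd 1 le_rfl le_rfl)
  intro j
  refine ⟨⟨?_, ?_⟩, fun i hi => ?_, fun i hi _ => ?_⟩
  · rw [injective_iff_map_eq_zero]
    intro c hc
    obtain ⟨b, rfl⟩ := h.surj c
    rw [← eval_nat] at hc
    obtain ⟨φ, hφ⟩ := (hdd.ex _).1 hc
    obtain ⟨a, rfl⟩ := (hA 0).refl.2 φ
    rw [eval_nat] at hφ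
    rw [← (hB 0).refl.1 hφ]
    exact (h.ex _).2 ⟨a, rfl⟩
  · intro ψ
    obtain ⟨χ, rfl⟩ := hdd.surj ψ
    obtain ⟨b, rfl⟩ := (hB 0).refl.2 χ
    exact ⟨g b, rfl⟩
  · obtain ⟨k, rfl⟩ := Nat.exists_eq_add_of_le' hi
    rcases Nat.eq_zero_or_pos k with rfl | hk
    · exact h3
    · exact h.V3 ((hA 0).v k hk) ((hB 0).v _ hi)
  · exact hd.V1 ((hB i).vd i hi le_rfl) ((hA (i + 1)).vd _ (by lia) le_rfl)

end refl

theorem ses_iff {A B C : ModuleCat.{u} R} :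
    SES R A B C ↔ ∃ (f : A →ₗ[R] B) (g : B →ₗ[R] C), Sx f g := by
  constructor
  · rintro ⟨f, g, h1, h2, h3⟩
    exact ⟨f, g, h1, h2, LinearMap.exact_iff.2 h3.symm⟩
  · rintro ⟨f, g, h⟩
    exact ⟨f, g, h.inj, h.surj, (LinearMap.exact_iff.1 h.ex).symm⟩

theorem ses_ker {B C : ModuleCat.{u} R} (g : B →ₗ[R] C) (hg : Function.Surjective g) :
    SES R (ModuleCat.of R (LinearMap.ker g)) B C :=
  ⟨(LinearMap.ker g).subtype, g, Subtype.val_injective, hg, by simp⟩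

theorem IsFinFree.tr {F : ModuleCat.{u} R} (h : IsFinFree R F) : IsTotallyReflexive R F := by
  have := h.1
  have := h.2
  exact (TR_iff F).2 TR.of_projective

theorem IsFinFree.prod {F G : ModuleCat.{u} R} (hF : IsFinFree R F) (hG : IsFinFree R G) :
    IsFinFree R (ModuleCat.of R (F × G)) := by
  have := hF.1
  have := hF.2
  have := hG.1
  have := hG.2
  exact ⟨inferInstanceAs (Module.Finite R (F × G)), inferInstanceAs (Module.Free R (F × G))⟩

theorem IsFinFree.pow {F : ModuleCat.{u} R} (hF : IsFinFree R F) (n : ℕ) :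
    IsFinFree R (MPow R F n) := by
  have := hF.1
  have := hF.2
  exact ⟨inferInstanceAs (Module.Finite R (Fin n → F)),
    inferInstanceAs (Module.Free R (Fin n → F))⟩

theorem ses_pow {A B C : ModuleCat.{u} R} (h : SES R A B C) (n : ℕ) :
    SES R (MPow R A n) (MPow R B n) (MPow R C n) := by
  obtain ⟨f, g, h⟩ := ses_iff.1 h
  refine ses_iff.2 ⟨(f.compLeft (Fin n) : (Fin n → A) →ₗ[R] (Fin n → B)),
    (g.compLeft (Fin n) : (Fin n → B) →ₗ[R] (Fin n → C)), ?_, ?_, ?_⟩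
  · intro x y hxy
    funext i
    exact h.inj (congrFun hxy i)
  · intro y
    choose x hx using fun i => h.surj (y i)
    exact ⟨x, funext hx⟩
  · intro x
    constructor
    · intro hx
      choose y hy using fun i => (h.ex (x i)).1 (congrFun hx i)
      exact ⟨y, funext hy⟩
    · rintro ⟨y, rfl⟩
      funext i
      exact (h.ex _).2 ⟨y i, rfl⟩

theorem exists_cover (K : ModuleCat.{u} R) (hK : Module.Finite R K) :
    ∃ K' F : ModuleCat.{u} R, IsFinFree R F ∧ SES R K' F K := by
  obtain ⟨n, f, hf⟩ := Module.Finite.exists_fin' R K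
  exact ⟨_, ModuleCat.of R (Fin n → R),
    ⟨inferInstanceAs (Module.Finite R (Fin n → R)), inferInstanceAs (Module.Free R (Fin n → R))⟩,
    ses_ker (B := ModuleCat.of R (Fin n → R)) f hf⟩

theorem finite_left [IsNoetherianRing R] {A B C : ModuleCat.{u} R} (h : SES R A B C)
    (hB : Module.Finite R B) : Module.Finite R A := by
  obtain ⟨f, g, h⟩ := ses_iff.1 h
  exact Module.Finite.of_injective f h.inj

/-- Horseshoe lemma. -/
theorem horseshoe {A B C A' C' F G : ModuleCat.{u} R} (h : SES R A B C)
    (hA : SES R A' F A) (hC : SES R C' G C) (hG : IsFinFree R G) :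
    ∃ B' : ModuleCat.{u} R, SES R B' (ModuleCat.of R (F × G)) B ∧ SES R A' B' C' := by
  obtain ⟨f, g, h⟩ := ses_iff.1 h
  obtain ⟨iA, pA, hA⟩ := ses_iff.1 hA
  obtain ⟨iC, pC, hC⟩ := ses_iff.1 hC
  have := hG.2
  obtain ⟨q, hq⟩ := Module.projective_lifting_property g pC h.surj
  have hq' : ∀ y, g (q y) = pC y := fun y => LinearMap.congr_fun hq y
  have hgf : ∀ a, g (f a) = 0 := fun a => (h.ex _).2 ⟨a, rfl⟩
  let φ : (F × G) →ₗ[R] B := (f ∘ₗ pA).coprod q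
  have hφ : ∀ x : F × G, φ x = f (pA x.1) + q x.2 := fun x => rfl
  have hφs : Function.Surjective φ := by
    intro b
    obtain ⟨y, hy⟩ := hC.surj (g b)
    obtain ⟨a, ha⟩ := (h.ex (b - q y)).1 (by rw [map_sub, hq', hy, sub_self])
    obtain ⟨x, rfl⟩ := hA.surj a
    exact ⟨(x, y), by rw [hφ, ha, sub_add_cancel]⟩
  refine ⟨_, ses_ker (B := ModuleCat.of R (F × G)) φ hφs, ?_⟩
  have hk : ∀ x : LinearMap.ker φ, pC x.1.2 = 0 := by
    intro x
    have h1 := congrArg g (hφ x.1)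
    rw [map_add, hgf, hq', zero_add] at h1
    rw [← h1, show φ x.1 = 0 from x.2, map_zero]
  let e : C' ≃ₗ[R] LinearMap.range iC := LinearEquiv.ofInjective iC hC.inj
  let β : LinearMap.ker φ →ₗ[R] LinearMap.range iC :=
    LinearMap.codRestrict _ (LinearMap.snd R F G ∘ₗ (LinearMap.ker φ).subtype)
      (fun x => (hC.ex _).1 (hk x))
  let α : A' →ₗ[R] LinearMap.ker φ :=
    LinearMap.codRestrict _ (LinearMap.inl R F G ∘ₗ iA) (fun x => by
      have : pA (iA x) = 0 := (hA.ex _).2 ⟨x, rfl⟩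
      change φ (iA x, 0) = 0
      rw [hφ]
      simp [this])
  have hβ : ∀ x, ((β x : LinearMap.range iC) : G) = x.1.2 := fun x => rfl
  have hα : ∀ x, ((α x : LinearMap.ker φ) : F × G) = (iA x, 0) := fun x => rfl
  refine ses_iff.2 ⟨α, e.symm.toLinearMap ∘ₗ β, ?_, ?_, ?_⟩
  · intro x y hxy
    have := congrArg (fun z : LinearMap.ker φ => z.1.1) hxy
    exact hA.inj this
  · rw [LinearMap.coe_comp]
    refine e.symm.surjective.comp ?_
    rintro ⟨y, hy⟩
    have hy0 : pC y = 0 := (hC.ex y).2 hy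
    obtain ⟨a, ha⟩ := (h.ex (q y)).1 (by rw [hq', hy0])
    obtain ⟨x, rfl⟩ := hA.surj a
    refine ⟨⟨(-x, y), ?_⟩, rfl⟩
    rw [LinearMap.mem_ker, hφ, map_neg, map_neg, ha]
    simp
  · intro x
    have key : (e.symm.toLinearMap ∘ₗ β) x = 0 ↔ x.1.2 = 0 := by
      rw [← hβ, LinearMap.comp_apply]
      simp
    rw [key]
    constructor
    · intro hx
      have h1 : φ x.1 = 0 := x.2
      rw [hφ, hx, map_zero, add_zero] at h1
      obtain ⟨a, ha⟩ := (hA.ex _).1 (h.inj (h1.trans (map_zero f).symm))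
      exact ⟨a, Subtype.ext (Prod.ext ha hx.symm)⟩
    · rintro ⟨a, rfl⟩
      rfl

theorem finFree_left [IsNoetherianRing R] [IsLocalRing R] {A B C : ModuleCat.{u} R}
    (h : SES R A B C) (hB : IsFinFree R B) (hC : IsFinFree R C) : IsFinFree R A := by
  have hfin := finite_left h hB.1
  obtain ⟨f, g, h⟩ := ses_iff.1 h
  have := hB.2
  have := hC.2
  obtain ⟨q, hq⟩ := Module.projective_lifting_property g LinearMap.id h.surj
  have hq' : ∀ y, g (q y) = y := fun y => LinearMap.congr_fun hq y
  let e : A ≃ₗ[R] LinearMap.range f := LinearEquiv.ofInjective f h.inj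
  let r : B →ₗ[R] LinearMap.range f := LinearMap.codRestrict _ (LinearMap.id - q ∘ₗ g)
    (fun b => (h.ex _).1 (by simp [hq']))
  have : Module.Projective R A := by
    refine Module.Projective.of_split f (e.symm.toLinearMap ∘ₗ r) ?_
    ext a
    have hgf : g (f a) = 0 := (h.ex _).2 ⟨a, rfl⟩
    have : r (f a) = e a := by
      apply Subtype.ext
      change f a - q (g (f a)) = f a
      rw [hgf, map_zero, sub_zero]
    simp [this]
  exact ⟨hfin, Module.free_of_flat_of_isLocalRing⟩

theorem syz_shift [IsNoetherianRing R] [IsLocalRing R] {K K' F : ModuleCat.{u} R}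
    (hF : IsFinFree R F) (hK : SES R K' F K) (n : ℕ) :
    ∀ S, IsSyzygy R n S K → ∃ S' F' : ModuleCat.{u} R, IsFinFree R F' ∧ SES R S' F' S ∧
      IsSyzygy R n S' K' := by
  induction n with
  | zero =>
    rintro S ⟨e⟩
    obtain ⟨f, g, h⟩ := ses_iff.1 hK
    refine ⟨K', F, hF, ses_iff.2 ⟨f, e.symm.toLinearMap ∘ₗ g, h.inj, ?_, ?_⟩,
      ⟨LinearEquiv.refl R K'⟩⟩
    · rw [LinearMap.coe_comp]
      exact e.symm.surjective.comp h.surj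
    · intro x
      rw [← h.ex x]
      simp
  | succ n ih =>
    rintro S ⟨T, G, hT, hG, hS⟩
    obtain ⟨T', F', hF', hT1, hT2⟩ := ih T hT
    obtain ⟨S', H, hH, hS'⟩ := exists_cover S (finite_left hS hG.1)
    obtain ⟨B', h1, h2⟩ := horseshoe hS hS' hT1 hF'
    exact ⟨S', H, hH, hS', T', B', hT2, finFree_left h1 (IsFinFree.prod hH hF') hG, h2⟩

/-- One step of a reducing sequence. -/
def Red (K L : ModuleCat.{u} R) : Prop :=
  ∃ (a b n : ℕ) (S : ModuleCat.{u} R), 0 < a ∧ 0 < b ∧ 0 < n ∧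
    IsSyzygy R n S (MPow R K b) ∧ SES R (MPow R K a) L S

theorem red_shift [IsNoetherianRing R] [IsLocalRing R] {K L K' F : ModuleCat.{u} R}
    (hF : IsFinFree R F) (hK : SES R K' F K) (h : Red K L) :
    ∃ L' H : ModuleCat.{u} R, IsFinFree R H ∧ SES R L' H L ∧ Red K' L' := by
  obtain ⟨a, b, n, S, ha, hb, hn, hS, hL⟩ := h
  obtain ⟨S', F', hF', hS1, hS2⟩ := syz_shift (IsFinFree.pow hF b) (ses_pow hK b) n S hS
  obtain ⟨L', h1, h2⟩ := horseshoe hL (ses_pow hK a) hS1 hF'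
  exact ⟨L', _, IsFinFree.prod (IsFinFree.pow hF a) hF', h1, a, b, n, S', ha, hb, hn, hS2, h2⟩

theorem resolved_prod {F : ModuleCat.{u} R} (hF : IsTotallyReflexive R F) (m : ℕ) :
    ∀ S, ResolvedBy R (IsTotallyReflexive R) m S →
      ResolvedBy R (IsTotallyReflexive R) m (ModuleCat.of R (S × F)) := by
  cases m with
  | zero =>
    rintro S ⟨G, hG, ⟨e⟩⟩
    exact ⟨ModuleCat.of R (G × F), (TR_iff _).2 (((TR_iff G).1 hG).prod ((TR_iff F).1 hF)),
      ⟨(e.prodCongr (LinearEquiv.refl R F) : (G × F) ≃ₗ[R] (S × F))⟩⟩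
  | succ m =>
    rintro S ⟨G, T, hG, hT, hm⟩
    refine ⟨ModuleCat.of R (G × F), T,
      (TR_iff _).2 (((TR_iff G).1 hG).prod ((TR_iff F).1 hF)), ?_, hm⟩
    obtain ⟨f, g, h⟩ := ses_iff.1 hT
    refine ses_iff.2 ⟨(LinearMap.inl R G F ∘ₗ f : T →ₗ[R] G × F),
      (g.prodMap LinearMap.id : G × F →ₗ[R] S × F), ?_, ?_, ?_⟩
    · intro x y hxy
      exact h.inj (congrArg Prod.fst hxy)
    · rintro ⟨s, x⟩
      obtain ⟨y, rfl⟩ := h.surj s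
      exact ⟨(y, x), rfl⟩
    · rintro ⟨y, x⟩
      constructor
      · intro hx
        obtain ⟨t, ht⟩ := (h.ex y).1 (congrArg Prod.fst hx)
        have hx0 : x = 0 := congrArg Prod.snd hx
        exact ⟨t, Prod.ext ht hx0.symm⟩
      · rintro ⟨t, ht⟩
        have h1 : f t = y := congrArg Prod.fst ht
        have h2 : 0 = x := congrArg Prod.snd ht
        exact Prod.ext ((h.ex y).2 ⟨t, h1⟩) h2.symm

theorem ses_tr_left {A B C : ModuleCat.{u} R} (h : SES R A B C)
    (hB : IsTotallyReflexive R B) (hC : IsTotallyReflexive R C) : IsTotallyReflexive R A := by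
  obtain ⟨f, g, h⟩ := ses_iff.1 h
  exact (TR_iff _).2 (h.TR_left ((TR_iff _).1 hB) ((TR_iff _).1 hC))

theorem resolved_ker {Y E G : ModuleCat.{u} R} (h : SES R Y E G)
    (hG : IsTotallyReflexive R G) (m : ℕ) (hE : ResolvedBy R (IsTotallyReflexive R) m E) :
    ResolvedBy R (IsTotallyReflexive R) m Y := by
  cases m with
  | zero =>
    obtain ⟨D, hD, ⟨e⟩⟩ := hE
    exact ⟨Y, ses_tr_left h ((TR_iff _).2 (((TR_iff D).1 hD).equiv e)) hG,
      ⟨LinearEquiv.refl R Y⟩⟩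
  | succ m =>
    obtain ⟨D, T, hD, hT, hm⟩ := hE
    obtain ⟨f, g, h⟩ := ses_iff.1 h
    obtain ⟨i, p, hi⟩ := ses_iff.1 hT
    have hs : Function.Surjective (g ∘ₗ p) := by
      rw [LinearMap.coe_comp]
      exact h.surj.comp hi.surj
    refine ⟨ModuleCat.of R (LinearMap.ker (g ∘ₗ p)), T, ses_tr_left (ses_ker (g ∘ₗ p) hs) hD hG,
      ?_, hm⟩
    let e : Y ≃ₗ[R] LinearMap.range f := LinearEquiv.ofInjective f h.inj
    let β : LinearMap.ker (g ∘ₗ p) →ₗ[R] LinearMap.range f :=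
      LinearMap.codRestrict _ (p ∘ₗ (LinearMap.ker (g ∘ₗ p)).subtype)
        (fun x => (h.ex _).1 x.2)
    let α : T →ₗ[R] LinearMap.ker (g ∘ₗ p) :=
      LinearMap.codRestrict _ i (fun t => by
        have : p (i t) = 0 := (hi.ex _).2 ⟨t, rfl⟩
        simp [this])
    have hβ : ∀ x, ((β x : LinearMap.range f) : E) = p x.1 := fun x => rfl
    refine ses_iff.2 ⟨α, e.symm.toLinearMap ∘ₗ β, ?_, ?_, ?_⟩
    · intro x y hxy
      exact hi.inj (congrArg Subtype.val hxy)
    · rw [LinearMap.coe_comp]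
      refine e.symm.surjective.comp ?_
      rintro ⟨y, hy⟩
      obtain ⟨d, rfl⟩ := hi.surj y
      exact ⟨⟨d, (h.ex _).2 hy⟩, rfl⟩
    · intro x
      have key : (e.symm.toLinearMap ∘ₗ β) x = 0 ↔ p x.1 = 0 := by
        rw [← hβ, LinearMap.comp_apply]
        simp
      rw [key, hi.ex x.1]
      constructor
      · rintro ⟨t, ht⟩
        exact ⟨t, Subtype.ext ht⟩
      · rintro ⟨t, rfl⟩
        exact ⟨t, rfl⟩

theorem finiteGdim_syz {Y F L : ModuleCat.{u} R} (hF : IsFinFree R F) (h : SES R Y F L)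
    (hL : FiniteGdim R L) : FiniteGdim R Y := by
  obtain ⟨m, hm⟩ := hL
  cases m with
  | zero =>
    obtain ⟨D, hD, ⟨e⟩⟩ := hm
    exact ⟨0, Y, ses_tr_left h (IsFinFree.tr hF) ((TR_iff _).2 (((TR_iff D).1 hD).equiv e)),
      ⟨LinearEquiv.refl R Y⟩⟩
  | succ m =>
    obtain ⟨G, S, hG, hS, hm⟩ := hm
    obtain ⟨i, p, h⟩ := ses_iff.1 h
    obtain ⟨f, g, hS⟩ := ses_iff.1 hS
    have := hF.2
    obtain ⟨q, hq⟩ := Module.projective_lifting_property g p hS.surj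
    have hq' : ∀ y, g (q y) = p y := fun y => LinearMap.congr_fun hq y
    have hgf : ∀ y, g (f y) = 0 := fun y => (hS.ex _).2 ⟨y, rfl⟩
    refine ⟨m, resolved_ker (E := ModuleCat.of R (S × F)) (G := G) ?_ hG m
      (resolved_prod (IsFinFree.tr hF) m S hm)⟩
    let φ : (S × F) →ₗ[R] G := f.coprod q
    have hφ : ∀ x : S × F, φ x = f x.1 + q x.2 := fun x => rfl
    let e : S ≃ₗ[R] LinearMap.range f := LinearEquiv.ofInjective f hS.inj
    let β : Y →ₗ[R] LinearMap.range f := LinearMap.codRestrict _ (q ∘ₗ i)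
      (fun y => (hS.ex _).1 (by
        rw [LinearMap.comp_apply, hq']
        exact (h.ex _).2 ⟨y, rfl⟩))
    have hβ : ∀ y, f (e.symm (β y)) = q (i y) := by
      intro y
      have : e (e.symm (β y)) = β y := e.apply_symm_apply _
      exact congrArg Subtype.val this
    refine ses_iff.2 ⟨((-(e.symm.toLinearMap ∘ₗ β)).prod i : Y →ₗ[R] S × F), φ, ?_, ?_, ?_⟩
    · intro x y hxy
      exact h.inj (congrArg Prod.snd hxy)
    · intro x
      obtain ⟨y, hy⟩ := h.surj (g x)
      obtain ⟨s, hs⟩ := (hS.ex (x - q y)).1 (by rw [map_sub, hq', hy, sub_self])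
      exact ⟨(s, y), by rw [hφ, hs, sub_add_cancel]⟩
    · rintro ⟨s, x⟩
      constructor
      · intro hx
        rw [hφ] at hx
        have h1 := congrArg g hx
        rw [map_add, hgf, hq', zero_add, map_zero] at h1
        obtain ⟨y, rfl⟩ := (h.ex x).1 h1
        refine ⟨y, Prod.ext ?_ rfl⟩
        apply hS.inj
        change f (-(e.symm (β y))) = f s
        rw [map_neg, hβ]
        exact (eq_neg_of_add_eq_zero_left hx).symm
      · rintro ⟨y, hy⟩
        have h1 : -(e.symm (β y)) = s := congrArg Prod.fst hy
        have h2 : i y = x := congrArg Prod.snd hy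
        rw [hφ, ← h1, ← h2, map_neg, hβ]
        simp

theorem tr_of_resolved (m : ℕ) : ∀ L : ModuleCat.{u} R,
    ResolvedBy R (IsTotallyReflexive R) m L → (∀ i, 1 ≤ i → V R L i) →
      IsTotallyReflexive R L := by
  induction m with
  | zero =>
    rintro L ⟨D, hD, ⟨e⟩⟩ _
    exact (TR_iff _).2 (((TR_iff D).1 hD).equiv e)
  | succ m ih =>
    rintro L ⟨G, S, hG, hS, hm⟩ hV
    obtain ⟨f, g, h⟩ := ses_iff.1 hS
    have hG' := (TR_iff _).1 hG
    have hS' := ih S hm (fun i hi => h.V1 ((hG' 0).v i hi) (hV _ (by lia)))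
    exact (TR_iff _).2 (h.TR_right ((TR_iff _).1 hS') hG' (hV 1 le_rfl))

theorem syz_V (p : ℕ) (n : ℕ) : ∀ S K : ModuleCat.{u} R, IsSyzygy R n S K →
    (∀ i, p < i → V R K i) → (∀ i, p < i → V R S i) := by
  induction n with
  | zero =>
    rintro S K ⟨e⟩ hV i hi
    exact V_retract e.symm.toLinearMap e.toLinearMap (by simp) (hV i hi)
  | succ n ih =>
    rintro S K ⟨T, F, hT, hF, h⟩ hV i hi
    obtain ⟨f, g, h⟩ := ses_iff.1 h
    exact h.V1 (((TR_iff F).1 (IsFinFree.tr hF) 0).v i (by lia)) (ih T K hT hV _ (by lia))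

theorem syz_Q (j : ℕ) (n : ℕ) : ∀ S K : ModuleCat.{u} R, IsSyzygy R n S K →
    Q R j K → Q R j S := by
  induction n with
  | zero =>
    rintro S K ⟨e⟩ hQ
    exact Q.retract e.symm.toLinearMap e.toLinearMap (by simp) hQ
  | succ n ih =>
    rintro S K ⟨T, F, hT, hF, h⟩ hQ
    obtain ⟨f, g, h⟩ := ses_iff.1 h
    exact (h.Q_left ((TR_iff F).1 (IsFinFree.tr hF)) (ih T K hT hQ)).mono (by lia)

theorem red_V {K L : ModuleCat.{u} R} (h : Red K L) (p : ℕ) (hV : ∀ i, p < i → V R K i) :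
    ∀ i, p < i → V R L i := by
  obtain ⟨a, b, n, S, ha, hb, hn, hS, hL⟩ := h
  obtain ⟨f, g, h⟩ := ses_iff.1 hL
  intro i hi
  exact h.V2 (V_pow (hV i hi) a) (syz_V p n S _ hS (fun i hi => V_pow (hV i hi) b) i hi)

/-- The key step. -/
theorem red_tr {K L : ModuleCat.{u} R} (h : Red K L) (hV : ∀ i, 1 ≤ i → V R K i)
    (hL : IsTotallyReflexive R L) : IsTotallyReflexive R K := by
  obtain ⟨a, b, n, S, ha, hb, hn, hS, hK⟩ := h
  obtain ⟨f, g, h⟩ := ses_iff.1 hK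
  have hL' := (TR_iff _).1 hL
  have hVS : V R S 1 := syz_V 0 n S _ hS (fun i hi => V_pow (hV i hi) b) 1 (by lia)
  have hSinj : Function.Injective (Module.Dual.eval R S) := by
    obtain ⟨n, rfl⟩ := Nat.exists_eq_add_of_le' hn
    obtain ⟨T, F, hT, hF, h⟩ := hS
    obtain ⟨f, g, h⟩ := ses_iff.1 h
    exact eval_inj_of_inj h.inj (IsFinFree.tr hF).1.1
  have hrefl := h.refl_left hVS (hL' 0).refl hSinj
  have hpow : Q R 0 (Fin a → K) :=
    ⟨hrefl, fun i hi => V_pow (hV i hi) a, fun i hi hi' => by lia⟩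
  refine (TR_iff _).2 fun j => ?_
  induction j with
  | zero => exact Q.of_pow ha hpow
  | succ j ih =>
    have h1 : Q R j S := syz_Q j n S _ hS (ih.pow b)
    exact Q.of_pow ha (h.Q_left hL' h1)

theorem red_finiteGdim [IsNoetherianRing R] [IsLocalRing R] (p : ℕ) :
    ∀ K L : ModuleCat.{u} R, Module.Finite R K → Red K L → FiniteGdim R L →
      (∀ i, p < i → V R K i) → FiniteGdim R K := by
  induction p with
  | zero =>
    rintro K L - h ⟨m, hm⟩ hV
    exact ⟨0, K, red_tr h hV (tr_of_resolved m L hm (red_V h 0 hV)), ⟨LinearEquiv.refl R K⟩⟩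
  | succ p ih =>
    intro K L hK h hL hV
    obtain ⟨K', F, hF, hK'⟩ := exists_cover K hK
    obtain ⟨L', H, hH, hL', hred⟩ := red_shift hF hK' h
    obtain ⟨f, g, hx⟩ := ses_iff.1 hK'
    obtain ⟨m, hm⟩ := ih K' L' (finite_left hK' hF.1) hred (finiteGdim_syz hH hL' hL)
      (fun i hi => hx.V1 (((TR_iff F).1 (IsFinFree.tr hF) 0).v i (by lia)) (hV _ (by lia)))
    exact ⟨m + 1, F, K', IsFinFree.tr hF, hK', hm⟩

theorem gdim_le [IsNoetherianRing R] (p : ℕ) :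
    ∀ M : ModuleCat.{u} R, Module.Finite R M → FiniteGdim R M →
      (∀ i, p < i → V R M i) → ResolvedBy R (IsTotallyReflexive R) p M := by
  induction p with
  | zero =>
    rintro M - ⟨m, hm⟩ hV
    exact ⟨M, tr_of_resolved m M hm hV, ⟨LinearEquiv.refl R M⟩⟩
  | succ p ih =>
    intro M hM hG hV
    obtain ⟨K', F, hF, hK'⟩ := exists_cover M hM
    obtain ⟨f, g, hx⟩ := ses_iff.1 hK'
    exact ⟨F, K', IsFinFree.tr hF, hK', ih K' (finite_left hK' hF.1) (finiteGdim_syz hF hK' hG)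
      (fun i hi => hx.V1 (((TR_iff F).1 (IsFinFree.tr hF) 0).v i (by lia)) (hV _ (by lia)))⟩

end GRed

theorem gdim_le_of_finiteRedGdim_of_ext_vanishing
    (R : Type u) [CommRing R] [IsNoetherianRing R] [IsLocalRing R]
    (M : ModuleCat.{u} R) (hM : Module.Finite R M) (p : ℕ)
    (hred : FiniteRedGdim R M)
    (hext : ∀ i : ℕ, p < i → ExtVanishes R M (ModuleCat.of R R) i) :
    ResolvedBy R (IsTotallyReflexive R) p M ∧ FiniteGdim R M := by
  have hV : ∀ i, p < i → GRed.V R M i := fun i hi =>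
    (GRed.extVanishes_iff_V M i (by lia)).1 (hext i hi)
  obtain ⟨r, K, hK0, ⟨hfin, a, b, n, ha, hb, hn, hS⟩, hlast⟩ := hred
  have hRed : ∀ i : Fin r, GRed.Red (K i.castSucc) (K i.succ) := fun i => by
    obtain ⟨S, h1, h2⟩ := hS i
    exact ⟨a i, b i, n i, S, ha i, hb i, hn i, h1, h2⟩
  have hVK : ∀ i, ∀ k, p < k → GRed.V R (K i) k := by
    intro i
    induction i using Fin.induction with
    | zero => rw [hK0]; exact hV
    | succ i ih => exact GRed.red_V (hRed i) p ih
  have hG : ∀ i, FiniteGdim R (K i) := by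
    intro i
    induction i using Fin.reverseInduction with
    | last => exact hlast
    | cast i ih =>
      exact GRed.red_finiteGdim p _ _ (hfin _) (hRed i) ih (hVK _)
  have hGM : FiniteGdim R M := hK0 ▸ hG 0
  exact ⟨GRed.gdim_le p M hM hGM hV, hGM⟩
end

section
/- Let R be a commutative Noetherian local ring and M a finitely generated R-module with Ext^i_R(M,M) = 0 for all i ≥ 1. Let K_0 = M, K_1, …, K_r be a reducing sequence for M. Then for each i = 0, …, r there is an R-module L_i such that K_i ≅ M ⊕ L_i (so M is a direct summand of K_i), and Ext^j_R(K_i, M) = 0 for all j ≥ 1. -/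
open CategoryTheory

universe u

variable (R : Type u) [CommRing R]

section ReducingHelpers

/-- All positive (derived category) Ext groups vanish. -/
def AVan (X Y : ModuleCat.{u} R) : Prop :=
  ∀ j : ℕ, 1 ≤ j → Subsingleton (Abelian.Ext.{u} X Y j)

theorem extVanishes_iff_exact {R : Type u} [CommRing R] (X Y : ModuleCat.{u} R) (n : ℕ)
    (P : ProjectiveResolution X) :
    ExtVanishes R X Y (n + 1) ↔ ∀ f : P.complex.X (n + 1) ⟶ Y,
      P.complex.d (n + 2) (n + 1) ≫ f = 0 → ∃ g : P.complex.X n ⟶ Y,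
        P.complex.d (n + 1) n ≫ g = f := by
  unfold ExtVanishes
  rw [(P.isoExt (R := R) (n + 1) Y).toLinearEquiv.toEquiv.subsingleton_congr,
    ← ModuleCat.isZero_iff_subsingleton, ← HomologicalComplex.exactAt_iff_isZero_homology,
    HomologicalComplex.exactAt_iff' _ n (n + 1) (n + 2) (by simp) (by simp),
    ShortComplex.moduleCat_exact_iff]
  rfl

theorem aext_iff_exact {R : Type u} [CommRing R] (X Y : ModuleCat.{u} R) (n : ℕ)
    (P : ProjectiveResolution X) :
    Subsingleton (Abelian.Ext.{u} X Y (n + 1)) ↔ ∀ f : P.complex.X (n + 1) ⟶ Y,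
      P.complex.d (n + 2) (n + 1) ≫ f = 0 → ∃ g : P.complex.X n ⟶ Y,
        P.complex.d (n + 1) n ≫ g = f := by
  constructor
  · intro h f hf
    exact (P.extMk_eq_zero_iff f (n + 2) rfl hf n rfl).1 (Subsingleton.elim _ _)
  · intro h
    refine subsingleton_of_forall_eq 0 fun α => ?_
    obtain ⟨f, hf, rfl⟩ := P.extMk_surjective α (n + 2) rfl
    exact (P.extMk_eq_zero_iff f (n + 2) rfl hf n rfl).2 (h f hf)

theorem aVan_iff {R : Type u} [CommRing R] (X Y : ModuleCat.{u} R) :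
    (∀ j : ℕ, 1 ≤ j → ExtVanishes R X Y j) ↔ AVan R X Y := by
  have key : ∀ n, ExtVanishes R X Y (n + 1) ↔ Subsingleton (Abelian.Ext.{u} X Y (n + 1)) :=
    fun n => (extVanishes_iff_exact X Y n (ProjectiveResolution.of X)).trans
      (aext_iff_exact X Y n (ProjectiveResolution.of X)).symm
  constructor
  · intro h j hj
    obtain ⟨n, rfl⟩ := Nat.exists_eq_add_of_le' hj
    exact (key n).1 (h _ hj)
  · intro h j hj
    obtain ⟨n, rfl⟩ := Nat.exists_eq_add_of_le' hj
    exact (key n).2 (h _ hj)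

theorem shortExact_of {R : Type u} [CommRing R] {A B C : ModuleCat.{u} R}
    (f : A →ₗ[R] B) (g : B →ₗ[R] C) (hf : Function.Injective f) (hg : Function.Surjective g)
    (h : LinearMap.range f = LinearMap.ker g) :
    ∃ w, (ShortComplex.mk (ModuleCat.ofHom f) (ModuleCat.ofHom g) w).ShortExact := by
  have w : ModuleCat.ofHom f ≫ ModuleCat.ofHom g = 0 := by
    ext x
    have : f x ∈ LinearMap.ker g := h ▸ ⟨x, rfl⟩
    simpa using this
  refine ⟨w, ?_⟩
  have hm : Mono (ModuleCat.ofHom f) := (ModuleCat.mono_iff_injective _).2 hf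
  have he : Epi (ModuleCat.ofHom g) := (ModuleCat.epi_iff_surjective _).2 hg
  refine @ShortComplex.ShortExact.mk _ _ _ _ ?_ hm he
  rw [ShortComplex.moduleCat_exact_iff]
  intro x hx
  have : x ∈ LinearMap.range f := h ▸ hx
  exact this

theorem aVan_mid {R : Type u} [CommRing R] {A B C Y : ModuleCat.{u} R}
    (h : SES R A B C) (hA : AVan R A Y) (hC : AVan R C Y) : AVan R B Y := by
  obtain ⟨f, g, hf, hg, e⟩ := h
  obtain ⟨w, hS⟩ := shortExact_of f g hf hg e
  intro j hj
  have := hA j hj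
  have := hC j hj
  refine subsingleton_of_forall_eq 0 fun x => ?_
  obtain ⟨x₃, rfl⟩ := Abelian.Ext.contravariant_sequence_exact₂ hS Y x
    (by exact (hA j hj).elim _ _)
  have : x₃ = 0 := (hC j hj).elim _ _
  rw [this, Abelian.Ext.comp_zero]

theorem aVan_left {R : Type u} [CommRing R] {A B C Y : ModuleCat.{u} R}
    (h : SES R A B C) (hB : AVan R B Y) (hC : AVan R C Y) : AVan R A Y := by
  obtain ⟨f, g, hf, hg, e⟩ := h
  obtain ⟨w, hS⟩ := shortExact_of f g hf hg e
  intro j hj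
  refine subsingleton_of_forall_eq 0 fun x => ?_
  obtain ⟨x₂, rfl⟩ := Abelian.Ext.contravariant_sequence_exact₁ hS Y x (n₁ := 1 + j) rfl
    (by exact (hC _ (by omega)).elim _ _)
  have : x₂ = 0 := (hB j hj).elim _ _
  rw [this, Abelian.Ext.comp_zero]

theorem aVan_proj {R : Type u} [CommRing R] {P Y : ModuleCat.{u} R}
    (h : Module.Projective R P) : AVan R P Y := by
  intro j hj
  obtain ⟨n, rfl⟩ := Nat.exists_eq_add_of_le' hj
  have : Projective P := (IsProjective.iff_projective (R := R) P).1 h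
  exact Abelian.Ext.subsingleton_of_projective ..

theorem aVan_equiv {R : Type u} [CommRing R] {A B Y : ModuleCat.{u} R}
    (e : A ≃ₗ[R] B) (hB : AVan R B Y) : AVan R A Y := by
  refine aVan_mid (A := ModuleCat.of R PUnit.{u + 1}) (C := B)
    ⟨0, e.toLinearMap, fun _ _ _ => rfl, e.surjective, ?_⟩ (aVan_proj ?_) hB
  · simp
  · exact inferInstanceAs (Module.Projective R PUnit.{u + 1})

theorem aVan_pow {R : Type u} [CommRing R] {A Y : ModuleCat.{u} R}
    (hA : AVan R A Y) : ∀ a, AVan R (MPow R A a) Y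
  | 0 => aVan_proj (inferInstanceAs (Module.Projective R (Fin 0 → A)))
  | a + 1 => by
    refine aVan_mid (A := A) (C := MPow R A a)
      ⟨LinearMap.single R (fun _ : Fin (a + 1) => (A : Type u)) 0,
        LinearMap.funLeft R A Fin.succ, ?_, ?_, ?_⟩ hA (aVan_pow hA a)
    · exact Pi.single_injective (M := fun _ : Fin (a + 1) => (A : Type u)) 0
    · exact LinearMap.funLeft_surjective_of_injective R A _ (Fin.succ_injective a)
    · ext x
      constructor
      · rintro ⟨y, rfl⟩
        refine LinearMap.mem_ker.2 (funext fun i => ?_)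
        exact Pi.single_eq_of_ne (M := fun _ : Fin (a + 1) => (A : Type u)) (Fin.succ_ne_zero i) y
      · intro hx
        refine ⟨(x : Fin (a + 1) → A) 0, funext fun i => ?_⟩
        refine Fin.cases ?_ (fun i => ?_) i
        · exact Pi.single_eq_same (M := fun _ : Fin (a + 1) => (A : Type u)) 0 ((x : Fin (a + 1) → A) 0)
        · exact (Pi.single_eq_of_ne (M := fun _ : Fin (a + 1) => (A : Type u)) (Fin.succ_ne_zero i)
            ((x : Fin (a + 1) → A) 0)).trans (congrFun hx i).symm

theorem aVan_syzygy {R : Type u} [CommRing R] {Y K : ModuleCat.{u} R} (hK : AVan R K Y) :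
    ∀ (n : ℕ) (S : ModuleCat.{u} R), IsSyzygy R n S K → AVan R S Y
  | 0, _, ⟨e⟩ => aVan_equiv e hK
  | n + 1, _, ⟨T, _, hT, hF, hS⟩ =>
    aVan_left hS (aVan_proj (by have := hF.2; infer_instance)) (aVan_syzygy hK n T hT)

theorem extend_of_aVan {R : Type u} [CommRing R] {A B C Y : ModuleCat.{u} R}
    (f : A →ₗ[R] B) (g : B →ₗ[R] C) (hf : Function.Injective f) (hg : Function.Surjective g)
    (h : LinearMap.range f = LinearMap.ker g) (hC : AVan R C Y) (p : A →ₗ[R] Y) :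
    ∃ q : B →ₗ[R] Y, q ∘ₗ f = p := by
  obtain ⟨w, hS⟩ := shortExact_of f g hf hg h
  obtain ⟨x₂, hx⟩ := Abelian.Ext.contravariant_sequence_exact₁ hS Y
    (Abelian.Ext.mk₀ (ModuleCat.ofHom p)) (n₁ := 1) rfl
    (by exact (hC _ le_rfl).elim _ _)
  obtain ⟨q, rfl⟩ := (Abelian.Ext.mk₀_bijective _ _).2 x₂
  rw [Abelian.Ext.mk₀_comp_mk₀] at hx
  have := (Abelian.Ext.mk₀_bijective _ _).1 hx
  exact ⟨q.hom, congrArg ModuleCat.Hom.hom this⟩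

theorem summand_iff {R : Type u} [CommRing R] (K M : ModuleCat.{u} R)
    (p : K →ₗ[R] M) (s : M →ₗ[R] K) (h : ∀ x, p (s x) = x) :
    ∃ L : ModuleCat.{u} R, Nonempty ((K : Type u) ≃ₗ[R] M × L) := by
  refine ⟨ModuleCat.of R (LinearMap.ker p), ⟨LinearEquiv.ofLinearMap
    (p.prod ((LinearMap.id - s ∘ₗ p).codRestrict (LinearMap.ker p) (fun x => by simp [h])))
    (s.coprod (LinearMap.ker p).subtype) ?_ ?_⟩⟩
  · ext x <;> simp [h]
  · ext x; simp

end ReducingHelpers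

theorem direct_summand_of_reducing_seq_of_self_ext_vanishing
    (R : Type u) [CommRing R] [IsNoetherianRing R] [IsLocalRing R]
    (M : ModuleCat.{u} R) (hM : Module.Finite R M)
    (hext : ∀ i : ℕ, 1 ≤ i → ExtVanishes R M M i)
    (r : ℕ) (K : Fin (r + 1) → ModuleCat.{u} R)
    (hK0 : K 0 = M) (hK : IsReducingSeq R K) :
    ∀ i : Fin (r + 1),
      (∃ L : ModuleCat.{u} R, Nonempty ((K i : Type u) ≃ₗ[R] M × L)) ∧
      (∀ j : ℕ, 1 ≤ j → ExtVanishes R (K i) M j) := by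
  obtain ⟨-, a, b, n, ha, hb, hn, H⟩ := hK
  suffices hs : ∀ i : Fin (r + 1),
      (∃ (p : K i →ₗ[R] M) (s : M →ₗ[R] K i), ∀ x, p (s x) = x) ∧ AVan R (K i) M by
    intro i
    obtain ⟨⟨p, s, h⟩, hv⟩ := hs i
    exact ⟨summand_iff _ _ p s h, (aVan_iff _ _).2 hv⟩
  intro i
  induction i using Fin.induction with
  | zero =>
    rw [hK0]
    exact ⟨⟨LinearMap.id, LinearMap.id, fun _ => rfl⟩, (aVan_iff _ _).1 hext⟩
  | succ i ih =>
    obtain ⟨⟨p, s, h⟩, hv⟩ := ih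
    obtain ⟨S, hS, hses⟩ := H i
    have hSv : AVan R S M := aVan_syzygy (aVan_pow hv _) _ _ hS
    refine ⟨?_, aVan_mid hses (aVan_pow hv _) hSv⟩
    obtain ⟨f, g, hf, hg, e⟩ := hses
    let i0 : Fin (a i) := ⟨0, ha i⟩
    let pr : MPow R (K i.castSucc) (a i) →ₗ[R] K i.castSucc :=
      LinearMap.proj (R := R) (φ := fun _ : Fin (a i) => (K i.castSucc : Type u)) i0
    let inc : K i.castSucc →ₗ[R] MPow R (K i.castSucc) (a i) :=
      LinearMap.single R (fun _ : Fin (a i) => (K i.castSucc : Type u)) i0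
    have hpi : ∀ x, pr (inc x) = x := fun x =>
      Pi.single_eq_same (M := fun _ : Fin (a i) => (K i.castSucc : Type u)) i0 x
    obtain ⟨q, hq⟩ := extend_of_aVan f g hf hg e hSv (p ∘ₗ pr)
    refine ⟨q, f ∘ₗ inc ∘ₗ s, fun x => ?_⟩
    have := LinearMap.congr_fun hq (inc (s x))
    simp only [LinearMap.comp_apply] at this ⊢
    rw [this, hpi, h]
end

section
/- Let R be a commutative Noetherian local ring and let P be a property of finitely generated R-modules that is closed under direct summands (i.e., if Y satisfies P and X is a direct summand of Y, then X satisfies P). Let M be a finitely generated R-module with Ext^i_R(M,M) = 0 for all i ≥ 1, and suppose M admits a reducing sequence K_0 = M, K_1, …, K_r such that K_r satisfies P. Then M satisfies P. -/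
open CategoryTheory

universe u

variable (R : Type u) [CommRing R]

section helpers

open Abelian

variable {R : Type u} [CommRing R]

lemma ses_shortExact {A B C : ModuleCat.{u} R} (f : A →ₗ[R] B) (g : B →ₗ[R] C)
    (hf : Function.Injective f) (hg : Function.Surjective g)
    (h : LinearMap.range f = LinearMap.ker g) :
    ∃ w, (ShortComplex.mk (ModuleCat.ofHom f) (ModuleCat.ofHom g) w).ShortExact := by
  have w : ModuleCat.ofHom f ≫ ModuleCat.ofHom g = 0 := by
    ext x
    have : f x ∈ LinearMap.ker g := h ▸ LinearMap.mem_range_self f x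
    simpa using this
  refine ⟨w, ?_⟩
  refine ShortComplex.ShortExact.mk' ?_ ?_ ?_
  · rw [ShortComplex.moduleCat_exact_iff_range_eq_ker]
    exact h
  · exact (ModuleCat.mono_iff_injective _).2 hf
  · exact (ModuleCat.epi_iff_surjective _).2 hg

/-- Bridge from the derived functor to `Abelian.Ext`. -/
lemma absExt_of_vanishes {M N : ModuleCat.{u} R} (n : ℕ)
    (h : ExtVanishes R M N (n + 1)) (x : Abelian.Ext.{u} M N (n + 1)) : x = 0 := by
  let Q : ProjectiveResolution M := projectiveResolution M
  obtain ⟨f, hf, rfl⟩ := Q.extMk_surjective x (n + 2) rfl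
  rw [Q.extMk_eq_zero_iff f (n + 2) rfl hf n rfl]
  have hz : Limits.IsZero ((Q.complex.linearYonedaObj R N).homology (n + 1)) := by
    refine Limits.IsZero.of_iso ?_ (Q.isoExt (R := R) (n + 1) N).symm
    exact @ModuleCat.isZero_of_subsingleton _ _ _ h
  rw [← HomologicalComplex.exactAt_iff_isZero_homology,
    HomologicalComplex.exactAt_iff' _ n (n + 1) (n + 2) (by simp) (by simp),
    ShortComplex.moduleCat_exact_iff] at hz
  obtain ⟨g, hg⟩ := hz f hf
  exact ⟨g, hg⟩

/-- All higher `Ext` groups into `M` vanish. -/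
def ExtGood (M X : ModuleCat.{u} R) : Prop :=
  ∀ (n : ℕ) (x : Abelian.Ext.{u} X M (n + 1)), x = 0

lemma ExtGood.pow {M X : ModuleCat.{u} R} (h : ExtGood M X) (b : ℕ) :
    ExtGood M (MPow R X b) := by
  intro n x
  obtain ⟨π, ι, key⟩ : ∃ (π : Fin b → (MPow R X b ⟶ X)) (ι : Fin b → (X ⟶ MPow R X b)),
      ∑ i : Fin b, π i ≫ ι i = 𝟙 (MPow R X b) := by
    refine ⟨fun i => ModuleCat.ofHom (LinearMap.proj (R := R) (φ := fun _ : Fin b => X) i),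
      fun i => ModuleCat.ofHom (LinearMap.single R (fun _ : Fin b => X) i), ?_⟩
    apply ModuleCat.hom_ext
    rw [ModuleCat.hom_sum]
    refine LinearMap.ext fun v => ?_
    rw [LinearMap.sum_apply]
    exact Finset.univ_sum_single v
  rw [← Ext.mk₀_id_comp x, ← key, Ext.mk₀_sum, Ext.sum_comp]
  refine Finset.sum_eq_zero fun i _ => ?_
  rw [← Ext.mk₀_comp_mk₀_assoc, h n ((Ext.mk₀ (ι i)).comp x (zero_add _)), Ext.comp_zero]

lemma ExtGood.syz {M : ModuleCat.{u} R} (n : ℕ) : ∀ {S X : ModuleCat.{u} R},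
    IsSyzygy R n S X → ExtGood M X → ExtGood M S := by
  induction n with
  | zero =>
    rintro S X ⟨e⟩ h n x
    have := (h n ((Ext.mk₀ (ModuleCat.ofHom e.symm.toLinearMap)).comp x (zero_add _)))
    have h2 := congrArg (fun y => (Ext.mk₀ (ModuleCat.ofHom e.toLinearMap)).comp y
      (zero_add (n + 1))) this
    have h3 : ModuleCat.ofHom e.toLinearMap ≫ ModuleCat.ofHom e.symm.toLinearMap = 𝟙 S := by
      ext; simp
    simpa [h3] using h2
  | succ k ih =>
    rintro S X ⟨T, F, hT, ⟨_, hF⟩, f, g, hf, hg, hfg⟩ h n x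
    obtain ⟨w, hS⟩ := ses_shortExact f g hf hg hfg
    have hTg := ih hT h
    have : Projective F :=
      (IsProjective.iff_projective _).1 (Module.Projective.of_free (R := R) (P := F))
    obtain ⟨y, rfl⟩ := Ext.contravariant_sequence_exact₁ hS M x (n₁ := n + 2) (by omega)
      (hTg _ _)
    rw [Ext.eq_zero_of_projective (P := F) y]
    simp

/-- Inductive step. -/
lemma step {M X Y S : ModuleCat.{u} R} {a b n : ℕ} (ha : 0 < a)
    (hs : IsSyzygy R n S (MPow R X b)) (hses : SES R (MPow R X a) Y S)
    (hX : ExtGood M X)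
    (hr : ∃ (i : M →ₗ[R] X) (p : X →ₗ[R] M), p ∘ₗ i = LinearMap.id) :
    ExtGood M Y ∧ ∃ (i : M →ₗ[R] Y) (p : Y →ₗ[R] M), p ∘ₗ i = LinearMap.id := by
  have hSg : ExtGood M S := ExtGood.syz n hs (hX.pow b)
  obtain ⟨f, g, hf, hg, hfg⟩ := hses
  obtain ⟨w, hS⟩ := ses_shortExact f g hf hg hfg
  refine ⟨fun m x => ?_, ?_⟩
  · obtain ⟨y, rfl⟩ := Ext.contravariant_sequence_exact₂ hS M x (hX.pow a _ _)
    rw [hSg m y]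
    simp
  · obtain ⟨i, p, hip⟩ := hr
    let q : MPow R X a →ₗ[R] M :=
      p ∘ₗ LinearMap.proj (R := R) (φ := fun _ : Fin a => X) ⟨0, ha⟩
    let j : M →ₗ[R] MPow R X a := LinearMap.single R (fun _ : Fin a => X) ⟨0, ha⟩ ∘ₗ i
    have hqj : ∀ m, q (j m) = m := fun m => by
      have := LinearMap.congr_fun hip m
      have h1 : q (j m) = p (Pi.single (M := fun _ : Fin a => X) ⟨0, ha⟩ (i m) ⟨0, ha⟩) := rfl
      rw [h1, Pi.single_eq_same]
      exact this
    obtain ⟨y, hy⟩ := Ext.contravariant_sequence_exact₁ hS M (Ext.mk₀ (ModuleCat.ofHom q))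
      (n₁ := 1) (by omega) (hSg 0 _)
    obtain ⟨t, rfl⟩ := Ext.addEquiv₀.symm.surjective y
    have ht : ModuleCat.ofHom f ≫ t = ModuleCat.ofHom q := by
      apply Ext.addEquiv₀.symm.injective
      simpa using hy
    refine ⟨f ∘ₗ j, t.hom, ?_⟩
    ext m
    have := congrArg (fun z => z.hom (j m)) ht
    exact this.trans (hqj m)

end helpers

theorem prop_of_reducing_seq_of_self_ext_vanishing
    (R : Type u) [CommRing R] [IsNoetherianRing R] [IsLocalRing R]
    (P : ModuleCat.{u} R → Prop)
    (hP : ∀ X Y : ModuleCat.{u} R,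
      (∃ Z : ModuleCat.{u} R, Nonempty ((Y : Type u) ≃ₗ[R] X × Z)) → P Y → P X)
    (M : ModuleCat.{u} R) (hM : Module.Finite R M)
    (hext : ∀ i : ℕ, 1 ≤ i → ExtVanishes R M M i)
    (r : ℕ) (K : Fin (r + 1) → ModuleCat.{u} R)
    (hK0 : K 0 = M) (hK : IsReducingSeq R K)
    (hKr : P (K (Fin.last r))) :
    P M := by
  obtain ⟨_, a, b, n, ha, _, _, hseq⟩ := hK
  have main : ∀ k : Fin (r + 1), ExtGood M (K k) ∧
      ∃ (i : M →ₗ[R] K k) (p : K k →ₗ[R] M), p ∘ₗ i = LinearMap.id := by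
    intro k
    induction k using Fin.induction with
    | zero =>
      rw [hK0]
      exact ⟨fun n x => absExt_of_vanishes n (hext (n + 1) (by omega)) x,
        LinearMap.id, LinearMap.id, rfl⟩
    | succ j ih =>
      obtain ⟨S, hS, hses⟩ := hseq j
      exact step (ha j) hS hses ih.1 ih.2
  obtain ⟨-, i, p, hip⟩ := main (Fin.last r)
  refine hP M _ ⟨ModuleCat.of R (LinearMap.ker p), ⟨?_⟩⟩ hKr
  have hpi : ∀ m, p (i m) = m := fun m => LinearMap.congr_fun hip m
  exact
    { toFun := fun y => (p y, ⟨y - i (p y), by simp [hpi]⟩)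
      map_add' := fun x y => by
        refine Prod.ext (by simp) (Subtype.ext ?_)
        simp only [map_add]
        exact add_sub_add_comm _ _ _ _
      map_smul' := fun c x => by
        refine Prod.ext (by simp) (Subtype.ext ?_)
        simp only [map_smul]
        exact (smul_sub _ _ _).symm
      invFun := fun z => i z.1 + z.2.1
      left_inv := fun y => by simp
      right_inv := fun z => by
        have hz : p z.2.1 = 0 := z.2.2
        refine Prod.ext (by simp [hpi, hz]) (Subtype.ext ?_)
        simp [hpi, hz] }
end

section
/- Let R be a commutative Noetherian local ring and M a finitely generated R-module with finite reducing Gorenstein dimension. If Ext^i_R(M,M) = 0 for all i ≥ 1, then M has finite Gorenstein dimension; in particular Ext^i_R(M,R) = 0 for all sufficiently large i. -/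
open CategoryTheory

universe u

variable (R : Type u) [CommRing R]

section Helpers

variable {R}

def EV (M N : ModuleCat.{u} R) (i : ℕ) : Prop := Subsingleton (Abelian.Ext.{u} M N i)

lemma ev_iff (M N : ModuleCat.{u} R) (n : ℕ) : ExtVanishes R M N (n+1) ↔ EV M N (n+1) := by
  let P := projectiveResolution M
  have h1 : EV M N (n+1) ↔ ∀ f : P.complex.X (n+1) ⟶ N, P.complex.d (n+2) (n+1) ≫ f = 0 →
      ∃ g : P.complex.X n ⟶ N, P.complex.d (n+1) n ≫ g = f := by
    constructor
    · intro h f hf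
      exact (P.extMk_eq_zero_iff f (n+2) rfl hf n rfl).1 (h.elim _ _)
    · intro h
      have : ∀ x : Abelian.Ext.{u} M N (n+1), x = 0 := by
        intro x
        obtain ⟨f, hf, rfl⟩ := P.extMk_surjective x (n+2) rfl
        exact (P.extMk_eq_zero_iff f (n+2) rfl hf n rfl).2 (h f hf)
      exact ⟨fun x y => by rw [this x, this y]⟩
  rw [h1]
  unfold ExtVanishes
  rw [← ModuleCat.isZero_iff_subsingleton, (P.isoExt (n+1) N).isZero_iff,
    ← HomologicalComplex.exactAt_iff_isZero_homology,
    HomologicalComplex.exactAt_iff' _ n (n+1) (n+2) (by simp) (by simp),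
    ShortComplex.moduleCat_exact_iff]
  constructor
  · intro h f hf
    obtain ⟨g, hg⟩ := h f hf
    exact ⟨g, hg⟩
  · intro h f hf
    obtain ⟨g, hg⟩ := h f hf
    exact ⟨g, hg⟩


lemma ev_retract {A B N : ModuleCat.{u} R} (f : A →ₗ[R] B) (p : B →ₗ[R] A)
    (h : p ∘ₗ f = LinearMap.id) {n : ℕ} (hB : EV B N n) : EV A N n := by
  have key : ∀ x : Abelian.Ext.{u} A N n, x = 0 := by
    intro x
    have e : ModuleCat.ofHom f ≫ ModuleCat.ofHom p = 𝟙 A := by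
      rw [← ModuleCat.ofHom_comp, h]; rfl
    rw [← Abelian.Ext.mk₀_id_comp x, ← e, ← Abelian.Ext.mk₀_comp_mk₀_assoc,
      hB.elim ((Abelian.Ext.mk₀ (ModuleCat.ofHom p)).comp x (zero_add n)) 0,
      Abelian.Ext.comp_zero]
  exact ⟨fun x y => by rw [key x, key y]⟩

lemma ev_pow {M N : ModuleCat.{u} R} {n : ℕ} (h : EV M N n) (b : ℕ) :
    EV (MPow R M b) N n := by
  have key : ∀ x : Abelian.Ext.{u} (MPow R M b) N n, x = 0 := by
    intro x
    let pr : ∀ _ : Fin b, MPow R M b ⟶ M := fun i => ModuleCat.ofHom (LinearMap.proj i)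
    let inc : ∀ _ : Fin b, M ⟶ MPow R M b :=
      fun i => ModuleCat.ofHom (LinearMap.single R (fun _ : Fin b => (M : Type u)) i)
    have e : 𝟙 (MPow R M b) = ∑ i, pr i ≫ inc i := by
      ext x
      change x = _
      rw [ModuleCat.hom_sum, LinearMap.sum_apply]
      exact (Finset.univ_sum_single (M := fun _ : Fin b => (M : Type u)) x).symm
    rw [← Abelian.Ext.mk₀_id_comp x, e, Abelian.Ext.mk₀_sum, Abelian.Ext.sum_comp]
    refine Finset.sum_eq_zero fun i _ => ?_
    rw [← Abelian.Ext.mk₀_comp_mk₀_assoc,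
      h.elim ((Abelian.Ext.mk₀ (inc i)).comp x (zero_add n)) 0, Abelian.Ext.comp_zero]
  exact ⟨fun x y => by rw [key x, key y]⟩

lemma ev_free {F : ModuleCat.{u} R} (h : Module.Projective R F) (N : ModuleCat.{u} R) (n : ℕ) :
    EV F N (n+1) := by
  have : Projective F := (IsProjective.iff_projective (R := R) F).1 h
  exact ⟨fun x y => by
    rw [Abelian.Ext.eq_zero_of_projective x, Abelian.Ext.eq_zero_of_projective y]⟩

section ses
variable {A B C : ModuleCat.{u} R}

/-- The short complex attached to a pair of composable maps. -/
def sesComplex (f : A →ₗ[R] B) (g : B →ₗ[R] C)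
    (hfg : LinearMap.range f = LinearMap.ker g) : ShortComplex (ModuleCat.{u} R) :=
  ShortComplex.mk (ModuleCat.ofHom f) (ModuleCat.ofHom g) (by
    ext x
    have : f x ∈ LinearMap.ker g := hfg ▸ LinearMap.mem_range_self f x
    exact this)

lemma sesComplex_shortExact (f : A →ₗ[R] B) (g : B →ₗ[R] C) (hf : Function.Injective f)
    (hg : Function.Surjective g) (hfg : LinearMap.range f = LinearMap.ker g) : (sesComplex f g hfg).ShortExact where
  exact := by
    rw [ShortComplex.moduleCat_exact_iff]
    intro x hx
    have : x ∈ LinearMap.range f := by rw [hfg]; exact hx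
    exact this
  mono_f := (ModuleCat.mono_iff_injective _).2 hf
  epi_g := (ModuleCat.epi_iff_surjective _).2 hg

variable {N : ModuleCat.{u} R} {n : ℕ}

lemma ev_mid (f : A →ₗ[R] B) (g : B →ₗ[R] C) (hf : Function.Injective f)
    (hg : Function.Surjective g) (hfg : LinearMap.range f = LinearMap.ker g)
    (hA : EV A N n) (hC : EV C N n) : EV B N n := by
  have hS := sesComplex_shortExact f g hf hg hfg
  have key : ∀ x : Abelian.Ext.{u} B N n, x = 0 := by
    intro x
    obtain ⟨y, hy⟩ := Abelian.Ext.contravariant_sequence_exact₂ hS N x (hA.elim _ _)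
    rw [← hy, hC.elim y 0]
    exact Abelian.Ext.comp_zero _ _ _ _ _
  exact ⟨fun x y => by rw [key x, key y]⟩

lemma ev_left (f : A →ₗ[R] B) (g : B →ₗ[R] C) (hf : Function.Injective f)
    (hg : Function.Surjective g) (hfg : LinearMap.range f = LinearMap.ker g)
    (hB : EV B N n) (hC : EV C N (n+1)) : EV A N n := by
  have hS := sesComplex_shortExact f g hf hg hfg
  have key : ∀ x : Abelian.Ext.{u} A N n, x = 0 := by
    intro x
    obtain ⟨y, hy⟩ := Abelian.Ext.contravariant_sequence_exact₁ hS N x (add_comm 1 n) (hC.elim _ _)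
    rw [← hy, hB.elim y 0]
    exact Abelian.Ext.comp_zero _ _ _ _ _
  exact ⟨fun x y => by rw [key x, key y]⟩

lemma ev_right (f : A →ₗ[R] B) (g : B →ₗ[R] C) (hf : Function.Injective f)
    (hg : Function.Surjective g) (hfg : LinearMap.range f = LinearMap.ker g)
    (hA : EV A N n) (hB : EV B N (n+1)) : EV C N (n+1) := by
  have hS := sesComplex_shortExact f g hf hg hfg
  have key : ∀ x : Abelian.Ext.{u} C N (n+1), x = 0 := by
    intro x
    obtain ⟨y, hy⟩ := Abelian.Ext.contravariant_sequence_exact₃ hS N x (hB.elim _ _)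
      (add_comm 1 n)
    rw [← hy, hA.elim y 0]
    exact Abelian.Ext.comp_zero _ _ _ _ _
  exact ⟨fun x y => by rw [key x, key y]⟩

lemma ev_extend (f : A →ₗ[R] B) (g : B →ₗ[R] C) (hf : Function.Injective f)
    (hg : Function.Surjective g) (hfg : LinearMap.range f = LinearMap.ker g)
    (hC : EV C N 1) (φ : A →ₗ[R] N) : ∃ ψ : B →ₗ[R] N, ψ ∘ₗ f = φ := by
  have hS := sesComplex_shortExact f g hf hg hfg
  obtain ⟨y, hy⟩ := Abelian.Ext.contravariant_sequence_exact₁ hS N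
    (Abelian.Ext.mk₀ (X := A) (ModuleCat.ofHom φ)) (add_comm 1 0) (hC.elim _ _)
  obtain ⟨ψ, rfl⟩ := (Abelian.Ext.mk₀_bijective _ _).2 y
  rw [Abelian.Ext.mk₀_comp_mk₀] at hy
  have := (Abelian.Ext.mk₀_bijective _ _).1 hy
  exact ⟨ψ.hom, congrArg ModuleCat.Hom.hom this⟩

lemma ev_right_one (f : A →ₗ[R] B) (g : B →ₗ[R] C) (hf : Function.Injective f)
    (hg : Function.Surjective g) (hfg : LinearMap.range f = LinearMap.ker g)
    (hB : EV B N 1) (h : ∀ φ : A →ₗ[R] N, ∃ ψ : B →ₗ[R] N, ψ ∘ₗ f = φ) :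
    EV C N 1 := by
  have hS := sesComplex_shortExact f g hf hg hfg
  have key : ∀ x : Abelian.Ext.{u} C N 1, x = 0 := by
    intro x
    obtain ⟨y, hy⟩ := Abelian.Ext.contravariant_sequence_exact₃ hS N x (hB.elim _ _)
      (add_comm 1 0)
    obtain ⟨φ, rfl⟩ := (Abelian.Ext.mk₀_bijective _ _).2 y
    obtain ⟨ψ, hψ⟩ := h φ.hom
    obtain ⟨ψ', hψ'⟩ : ∃ ψ' : (sesComplex f g hfg).X₂ ⟶ N, (sesComplex f g hfg).f ≫ ψ' = φ := by
      refine ⟨ModuleCat.ofHom ψ, ?_⟩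
      ext x
      exact LinearMap.congr_fun hψ x
    rw [← hy, ← hψ', ← Abelian.Ext.mk₀_comp_mk₀, hS.extClass_comp_assoc]
    rfl
  exact ⟨fun x y => by rw [key x, key y]⟩

end ses

lemma ev_syzygy {N : ModuleCat.{u} R} : ∀ (n : ℕ) (S K : ModuleCat.{u} R), IsSyzygy R n S K →
    (∀ j, EV K N (j+1)) → ∀ j, EV S N (j+1)
  | 0, S, K, ⟨e⟩, h, j =>
    ev_retract (e : S →ₗ[R] K) (e.symm : K →ₗ[R] S) (by ext x; simp) (h j)
  | n+1, S, K, ⟨T, F, hT, hF, f, g, hf, hg, hfg⟩, h, j => by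
    have := hF.2
    exact ev_left f g hf hg hfg (ev_free inferInstance N j) (ev_syzygy n T K hT h (j+1))

/-- Total reflexivity rephrased with `EV`. -/
def TR (G : ModuleCat.{u} R) : Prop :=
  Function.Bijective (Module.Dual.eval R G) ∧
    ∀ i : ℕ, EV G (ModuleCat.of R R) (i+1) ∧
      EV (ModuleCat.of R (Module.Dual R G)) (ModuleCat.of R R) (i+1)

lemma tr_iff (G : ModuleCat.{u} R) : IsTotallyReflexive R G ↔ TR G := by
  unfold IsTotallyReflexive TR
  refine and_congr Iff.rfl ⟨fun h i => ?_, fun h i hi => ?_⟩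
  · simpa only [ev_iff] using h (i+1) (by omega)
  · obtain ⟨k, rfl⟩ := Nat.exists_eq_add_of_le' hi
    simpa only [ev_iff] using h k

/-- The dual as an object of `ModuleCat`. -/
abbrev dualObj (A : ModuleCat.{u} R) : ModuleCat.{u} R := ModuleCat.of R (Module.Dual R A)

lemma tr_kernel {A B C : ModuleCat.{u} R} (f : A →ₗ[R] B) (g : B →ₗ[R] C)
    (hf : Function.Injective f) (hg : Function.Surjective g)
    (hfg : LinearMap.range f = LinearMap.ker g) (hB : TR B) (hC : TR C) : TR A := by
  have hgf : ∀ a, g (f a) = 0 := fun a => by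
    have : f a ∈ LinearMap.ker g := hfg ▸ LinearMap.mem_range_self f a
    exact this
  have hsurj : Function.Surjective f.dualMap := by
    intro φ
    obtain ⟨ψ, hψ⟩ := ev_extend (N := ModuleCat.of R R) f g hf hg hfg (hC.2 0).1 φ
    exact ⟨ψ, hψ⟩
  have hinj : Function.Injective g.dualMap := LinearMap.dualMap_injective_of_surjective hg
  have hex : LinearMap.range g.dualMap = LinearMap.ker f.dualMap := by
    rw [LinearMap.range_dualMap_eq_dualAnnihilator_ker_of_surjective g hg,
      LinearMap.ker_dualMap_eq_dualAnnihilator_range, hfg]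
  refine ⟨⟨?_, ?_⟩, fun i => ⟨ev_left f g hf hg hfg (hB.2 i).1 (hC.2 (i+1)).1, ?_⟩⟩
  · rw [injective_iff_map_eq_zero]
    intro a ha
    apply hf
    rw [map_zero]
    apply hB.1.1
    rw [map_zero]
    ext ψ
    exact LinearMap.congr_fun ha (f.dualMap ψ)
  · intro ξ
    obtain ⟨b, hb⟩ := hB.1.2 (ξ ∘ₗ f.dualMap)
    have hgb : g b = 0 := by
      apply hC.1.1
      rw [map_zero]
      ext χ
      have h1 := LinearMap.congr_fun hb (g.dualMap χ)
      have h2 : f.dualMap (g.dualMap χ) = 0 := by ext a; simp [hgf]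
      simpa [h2] using h1
    have : b ∈ LinearMap.range f := by rw [hfg]; exact hgb
    obtain ⟨a, rfl⟩ := this
    refine ⟨a, ?_⟩
    ext φ
    obtain ⟨ψ, rfl⟩ := hsurj φ
    exact LinearMap.congr_fun hb ψ
  · cases i with
    | zero =>
      refine ev_right_one (A := dualObj C) (B := dualObj B) (C := dualObj A)
        g.dualMap f.dualMap hinj hsurj hex (hB.2 0).2 ?_
      intro φ
      obtain ⟨c, hc⟩ := hC.1.2 φ
      obtain ⟨b, rfl⟩ := hg c
      refine ⟨Module.Dual.eval R B b, ?_⟩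
      rw [← hc]
      rfl
    | succ i =>
      exact ev_right (A := dualObj C) (B := dualObj B) (C := dualObj A)
        g.dualMap f.dualMap hinj hsurj hex (hC.2 i).2 (hB.2 (i+1)).2

lemma tr_retract {A B : ModuleCat.{u} R} (f : A →ₗ[R] B) (p : B →ₗ[R] A)
    (h : p ∘ₗ f = LinearMap.id) (hB : TR B) : TR A := by
  have hp : ∀ a, p (f a) = a := fun a => LinearMap.congr_fun h a
  have hd : f.dualMap ∘ₗ p.dualMap = LinearMap.id := by
    ext φ a
    change φ (p (f a)) = φ a
    rw [hp]
  refine ⟨⟨?_, ?_⟩, fun i => ⟨ev_retract f p h (hB.2 i).1,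
    ev_retract (A := dualObj A) (B := dualObj B) p.dualMap f.dualMap hd (hB.2 i).2⟩⟩
  · rw [injective_iff_map_eq_zero]
    intro a ha
    rw [← hp a]
    have : f a = 0 := by
      apply hB.1.1
      rw [map_zero]
      ext ψ
      exact LinearMap.congr_fun ha (f.dualMap ψ)
    rw [this, map_zero]
  · intro ξ
    obtain ⟨b, hb⟩ := hB.1.2 (ξ ∘ₗ f.dualMap)
    refine ⟨p b, ?_⟩
    ext φ
    have h1 := LinearMap.congr_fun hb (p.dualMap φ)
    have h2 : f.dualMap (p.dualMap φ) = φ := LinearMap.congr_fun hd φ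
    simpa [h2] using h1

lemma tr_free {F : ModuleCat.{u} R} (hF : IsFinFree R F) : TR F := by
  have := hF.1
  have := hF.2
  exact ⟨Module.bijective_dual_eval R F, fun i => ⟨ev_free inferInstance _ i,
    ev_free (F := dualObj F) (inferInstanceAs (Module.Projective R (Module.Dual R F))) _ i⟩⟩

/-- The product as an object of `ModuleCat`. -/
abbrev prodObj (A B : ModuleCat.{u} R) : ModuleCat.{u} R := ModuleCat.of R (A × B)

lemma tr_prod {A B : ModuleCat.{u} R} (hA : TR A) (hB : TR B) : TR (prodObj A B) := by
  refine ⟨⟨?_, ?_⟩, fun i => ⟨?_, ?_⟩⟩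
  · rw [injective_iff_map_eq_zero]
    rintro ⟨a, b⟩ hab
    have ha : a = 0 := by
      apply hA.1.1
      rw [map_zero]
      ext ψ
      exact LinearMap.congr_fun hab ((LinearMap.fst R A B).dualMap ψ)
    have hb : b = 0 := by
      apply hB.1.1
      rw [map_zero]
      ext ψ
      exact LinearMap.congr_fun hab ((LinearMap.snd R A B).dualMap ψ)
    rw [ha, hb]
    rfl
  · intro ξ
    obtain ⟨a, ha⟩ := hA.1.2 (ξ ∘ₗ (LinearMap.fst R A B).dualMap)
    obtain ⟨b, hb⟩ := hB.1.2 (ξ ∘ₗ (LinearMap.snd R A B).dualMap)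
    refine ⟨(a, b), ?_⟩
    ext (φ : (A × B) →ₗ[R] R)
    have h1 := LinearMap.congr_fun ha ((LinearMap.inl R A B).dualMap φ)
    have h2 := LinearMap.congr_fun hb ((LinearMap.inr R A B).dualMap φ)
    have h3 : φ = (LinearMap.fst R A B).dualMap ((LinearMap.inl R A B).dualMap φ) +
        (LinearMap.snd R A B).dualMap ((LinearMap.inr R A B).dualMap φ) := by
      refine LinearMap.ext fun x => ?_
      change φ x = φ (x.1, 0) + φ (0, x.2)
      rw [← map_add]
      simp
    have h4 : ξ φ = ξ ((LinearMap.fst R A B).dualMap ((LinearMap.inl R A B).dualMap φ)) +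
        ξ ((LinearMap.snd R A B).dualMap ((LinearMap.inr R A B).dualMap φ)) :=
      (congrArg ξ h3).trans (map_add ξ _ _)
    rw [h4]
    refine Eq.trans ?_ (congrArg₂ (· + ·) h1 h2)
    change φ (a, b) = φ (a, 0) + φ (0, b)
    rw [← map_add]
    simp
  · exact ev_mid (A := A) (B := prodObj A B) (C := B) (LinearMap.inl R A B) (LinearMap.snd R A B)
      LinearMap.inl_injective LinearMap.snd_surjective (LinearMap.range_inl R A B)
      (hA.2 i).1 (hB.2 i).1
  · refine ev_mid (A := dualObj B) (B := dualObj (prodObj A B)) (C := dualObj A)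
      (LinearMap.snd R A B).dualMap (LinearMap.inl R A B).dualMap
      (LinearMap.dualMap_injective_of_surjective LinearMap.snd_surjective) ?_ ?_
      (hB.2 i).2 (hA.2 i).2
    · intro φ
      exact ⟨(LinearMap.fst R A B).dualMap φ, by ext x; simp⟩
    · rw [LinearMap.range_dualMap_eq_dualAnnihilator_ker_of_surjective _ LinearMap.snd_surjective,
        LinearMap.ker_dualMap_eq_dualAnnihilator_range, LinearMap.range_inl]

lemma lift_through {A B X : Type u} [AddCommGroup A] [AddCommGroup B] [AddCommGroup X]
    [Module R A] [Module R B] [Module R X] (f : A →ₗ[R] B) (hf : Function.Injective f)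
    (φ : X →ₗ[R] B) (h : ∀ x, φ x ∈ LinearMap.range f) : ∃ ψ : X →ₗ[R] A, ∀ x, f (ψ x) = φ x := by
  refine ⟨(LinearEquiv.ofInjective f hf).symm.toLinearMap ∘ₗ φ.codRestrict _ h, fun x => ?_⟩
  have := (LinearEquiv.ofInjective f hf).apply_symm_apply (φ.codRestrict _ h x)
  exact congrArg Subtype.val this

/-- Resolutions of length `m` by totally reflexive modules. -/
abbrev RT (m : ℕ) (M : ModuleCat.{u} R) : Prop := ResolvedBy R TR m M

lemma rt_iff (m : ℕ) (M : ModuleCat.{u} R) : ResolvedBy R (IsTotallyReflexive R) m M ↔ RT m M := by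
  have : IsTotallyReflexive R = TR := by
    funext G
    exact propext (tr_iff G)
  rw [this]

lemma rt_zero {M : ModuleCat.{u} R} : RT 0 M ↔ TR M := by
  constructor
  · rintro ⟨G, hG, ⟨e⟩⟩
    exact tr_retract (e.symm : M →ₗ[R] G) (e : G →ₗ[R] M) (by ext x; simp) hG
  · exact fun h => ⟨M, h, ⟨LinearEquiv.refl R M⟩⟩

lemma rt_kernel : ∀ (m : ℕ) {A B C : ModuleCat.{u} R} (f : A →ₗ[R] B) (g : B →ₗ[R] C)
    (_ : Function.Injective f) (_ : Function.Surjective g)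
    (_ : LinearMap.range f = LinearMap.ker g) (_ : RT m B) (_ : TR C), RT m A
  | 0, A, B, C, f, g, hf, hg, hfg, hB, hC =>
    rt_zero.2 (tr_kernel f g hf hg hfg (rt_zero.1 hB) hC)
  | m+1, A, B, C, f, g, hf, hg, hfg, ⟨G, S, hG, ⟨s, q, hs, hq, hsq⟩, hS⟩, hC => by
    have hqs : ∀ x, q (s x) = 0 := fun x => by
      have : s x ∈ LinearMap.ker q := hsq ▸ LinearMap.mem_range_self s x
      exact this
    let L := LinearMap.ker (g ∘ₗ q)
    have hL : TR (ModuleCat.of R L) :=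
      tr_kernel (A := ModuleCat.of R L) L.subtype (g ∘ₗ q) L.injective_subtype (hg.comp hq)
        L.range_subtype hG hC
    obtain ⟨t, ht⟩ := lift_through f hf (q ∘ₗ L.subtype) (fun x => by rw [hfg]; exact x.2)
    have ht' : ∀ x : L, f (t x) = q x := ht
    refine ⟨ModuleCat.of R L, S, hL, ⟨s.codRestrict L (fun x => ?_), t, ?_, ?_, ?_⟩, hS⟩
    · change g (q (s x)) = 0
      rw [hqs, map_zero]
    · intro x y hxy
      exact hs (congrArg Subtype.val hxy)
    · intro a
      obtain ⟨y, hy⟩ := hq (f a)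
      have hy' : y ∈ L := by
        change g (q y) = 0
        rw [hy]
        have : f a ∈ LinearMap.ker g := hfg ▸ LinearMap.mem_range_self f a
        exact this
      refine ⟨⟨y, hy'⟩, hf ?_⟩
      rw [ht', hy]
    · ext (x : L)
      constructor
      · rintro ⟨y, rfl⟩
        exact hf (((ht' _).trans (hqs y)).trans (map_zero f).symm)
      · intro hx
        have hx' : t x = 0 := hx
        have : (x : G) ∈ LinearMap.range s := by
          rw [hsq]
          change q x = 0
          rw [← ht', hx', map_zero]
        obtain ⟨y, hy⟩ := this
        exact ⟨y, Subtype.ext hy⟩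

lemma rt_prod_free {F : ModuleCat.{u} R} (hF : IsFinFree R F) : ∀ (m : ℕ) {B : ModuleCat.{u} R},
    RT m B → RT m (prodObj B F)
  | 0, B, hB => rt_zero.2 (tr_prod (rt_zero.1 hB) (tr_free hF))
  | m+1, B, ⟨G, S, hG, ⟨s, q, hs, hq, hsq⟩, hS⟩ => by
    refine ⟨prodObj G F, S, tr_prod hG (tr_free hF), ⟨LinearMap.inl R G F ∘ₗ s,
      LinearMap.prodMap q LinearMap.id, ?_, ?_, ?_⟩, hS⟩
    · exact LinearMap.inl_injective.comp hs
    · rintro ⟨b, x⟩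
      obtain ⟨y, rfl⟩ := hq b
      exact ⟨(y, x), rfl⟩
    · ext ⟨y, x⟩
      constructor
      · rintro ⟨z, hz⟩
        have h1 : s z = y := congrArg Prod.fst hz
        have h2 : 0 = x := congrArg Prod.snd hz
        have h3 : s z ∈ LinearMap.ker q := hsq ▸ LinearMap.mem_range_self s z
        subst h1 h2
        exact Prod.ext h3 rfl
      · intro h
        have h1 : q y = 0 := congrArg Prod.fst h
        have h2 : x = 0 := congrArg Prod.snd h
        have h3 : y ∈ LinearMap.range s := by rw [hsq]; exact h1
        obtain ⟨z, rfl⟩ := h3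
        exact ⟨z, Prod.ext rfl h2.symm⟩

lemma rt_syz {m : ℕ} {K' F K : ModuleCat.{u} R} (hF : IsFinFree R F) (j : K' →ₗ[R] F)
    (p : F →ₗ[R] K) (hj : Function.Injective j) (hp : Function.Surjective p)
    (hjp : LinearMap.range j = LinearMap.ker p) (hK : RT (m+1) K) : RT m K' := by
  obtain ⟨G, S, hG, ⟨s, q, hs, hq, hsq⟩, hS⟩ := hK
  have := hF.2
  obtain ⟨h, hh⟩ := Module.projective_lifting_property q p hq
  have hh' : ∀ x, q (h x) = p x := fun x => LinearMap.congr_fun hh x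
  have hpj : ∀ x, p (j x) = 0 := fun x => by
    have : j x ∈ LinearMap.ker p := hjp ▸ LinearMap.mem_range_self j x
    exact this
  have hqs : ∀ x, q (s x) = 0 := fun x => by
    have : s x ∈ LinearMap.ker q := hsq ▸ LinearMap.mem_range_self s x
    exact this
  obtain ⟨t, ht⟩ := lift_through s hs (-(h ∘ₗ j)) (fun x => by
    rw [hsq]
    change q (-(h (j x))) = 0
    rw [map_neg, hh', hpj, neg_zero])
  have ht' : ∀ x, s (t x) = -(h (j x)) := ht
  refine rt_kernel m (A := K') (B := prodObj S F) (C := G) (t.prod j) (s.coprod h) ?_ ?_ ?_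
    (rt_prod_free hF m hS) hG
  · intro x y hxy
    exact hj (congrArg Prod.snd hxy)
  · intro y
    obtain ⟨x, hx⟩ := hp (q y)
    have : y - h x ∈ LinearMap.range s := by
      rw [hsq]
      change q (y - h x) = 0
      rw [map_sub, hh', hx, sub_self]
    obtain ⟨z, hz⟩ := this
    refine ⟨(z, x), ?_⟩
    change s z + h x = y
    rw [hz, sub_add_cancel]
  · ext ⟨z, x⟩
    constructor
    · rintro ⟨k, hk⟩
      have h1 : t k = z := congrArg Prod.fst hk
      have h2 : j k = x := congrArg Prod.snd hk
      subst h1 h2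
      change s (t k) + h (j k) = 0
      rw [ht', neg_add_cancel]
    · intro hzx
      have h0 : s z + h x = 0 := hzx
      have h1 : x ∈ LinearMap.range j := by
        rw [hjp]
        change p x = 0
        rw [← hh', eq_neg_of_add_eq_zero_right h0, map_neg, hqs, neg_zero]
      obtain ⟨k, rfl⟩ := h1
      refine ⟨k, Prod.ext (hs ?_) rfl⟩
      change s (t k) = s z
      rw [ht', ← eq_neg_of_add_eq_zero_left h0]

lemma rt_retract [IsNoetherianRing R] : ∀ (m : ℕ) {M K : ModuleCat.{u} R} (_ : Module.Finite R M)
    (_ : Module.Finite R K) (f : M →ₗ[R] K) (p : K →ₗ[R] M) (_ : p ∘ₗ f = LinearMap.id)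
    (_ : RT m K), RT m M
  | 0, M, K, _, _, f, p, hpf, h => rt_zero.2 (tr_retract f p hpf (rt_zero.1 h))
  | m+1, M, K, hM, hK, f, p, hpf, h => by
    have hp : ∀ a, p (f a) = a := fun a => LinearMap.congr_fun hpf a
    obtain ⟨a, π, hπ⟩ := Module.Finite.exists_fin' R M
    obtain ⟨b, ρ, hρ⟩ := Module.Finite.exists_fin' R (LinearMap.ker p)
    let F : ModuleCat.{u} R := ModuleCat.of R ((Fin a → R) × (Fin b → R))
    have hF : IsFinFree R F :=
      ⟨inferInstanceAs (Module.Finite R ((Fin a → R) × (Fin b → R))),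
        inferInstanceAs (Module.Free R ((Fin a → R) × (Fin b → R)))⟩
    let σ : ((Fin a → R) × (Fin b → R)) →ₗ[R] K :=
      (f ∘ₗ π).coprod ((LinearMap.ker p).subtype ∘ₗ ρ)
    have hσa : ∀ x y, σ (x, y) = f (π x) + (ρ y : K) := fun x y => rfl
    have hσ : Function.Surjective σ := by
      intro k
      obtain ⟨x, hx⟩ := hπ (p k)
      obtain ⟨y, hy⟩ := hρ ⟨k - f (p k), by simp [hp]⟩
      refine ⟨(x, y), ?_⟩
      rw [hσa, hx, hy]
      simp
    let K' : ModuleCat.{u} R := ModuleCat.of R (LinearMap.ker σ)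
    have hK' : RT m K' := rt_syz (K' := K') hF (LinearMap.ker σ).subtype σ
      (Submodule.injective_subtype _) hσ (Submodule.range_subtype _) h
    let M' : ModuleCat.{u} R := ModuleCat.of R (LinearMap.ker π)
    have hM' : RT m M' := by
      refine rt_retract m (M := M') (K := K')
        (inferInstanceAs (Module.Finite R (LinearMap.ker π)))
        (inferInstanceAs (Module.Finite R (LinearMap.ker σ)))
        ((LinearMap.inl R _ _ ∘ₗ (LinearMap.ker π).subtype).codRestrict (LinearMap.ker σ) ?_)
        ((LinearMap.fst R _ _ ∘ₗ (LinearMap.ker σ).subtype).codRestrict (LinearMap.ker π) ?_)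
        ?_ hK'
      · rintro ⟨x, hx⟩
        change σ (x, 0) = 0
        have hx' : π x = 0 := hx
        simp [hσa, hx']
      · rintro ⟨⟨x, y⟩, hxy⟩
        change π x = 0
        have h1 : f (π x) + (ρ y : K) = 0 := hxy
        have h2 := congrArg p h1
        have h3 : p (ρ y : K) = 0 := (ρ y).2
        simpa [hp, h3] using h2
      · ext x
        rfl
    refine ⟨ModuleCat.of R (Fin a → R), M', tr_free ⟨inferInstanceAs (Module.Finite R (Fin a → R)),
      inferInstanceAs (Module.Free R (Fin a → R))⟩, ⟨(LinearMap.ker π).subtype, π,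
      Submodule.injective_subtype _, hπ, Submodule.range_subtype _⟩, hM'⟩

lemma rt_ev : ∀ (m : ℕ) {M : ModuleCat.{u} R} (_ : RT m M) (i : ℕ),
    EV M (ModuleCat.of R R) (i + m + 1)
  | 0, M, h, i => ((rt_zero.1 h).2 i).1
  | m+1, M, ⟨G, S, hG, ⟨s, q, hs, hq, hsq⟩, hS⟩, i =>
    ev_right s q hs hq hsq (rt_ev m hS i) (hG.2 (i+m+1)).1

lemma summand_of_redSeq {r : ℕ} (K : Fin (r+1) → ModuleCat.{u} R) (hK : IsReducingSeq R K)
    (h0 : ∀ j, EV (K 0) (K 0) (j+1)) (i : Fin (r+1)) :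
    (∃ (f : K 0 →ₗ[R] K i) (p : K i →ₗ[R] K 0), p ∘ₗ f = LinearMap.id) ∧
      ∀ j, EV (K i) (K 0) (j+1) := by
  obtain ⟨_, a, b, n, ha, _, _, hseq⟩ := hK
  induction i using Fin.induction with
  | zero => exact ⟨⟨LinearMap.id, LinearMap.id, rfl⟩, h0⟩
  | succ i ih =>
    obtain ⟨⟨f, p, hpf⟩, hev⟩ := ih
    obtain ⟨S, hS, s, q, hs, hq, hsq⟩ := hseq i
    have hSev : ∀ j, EV S (K 0) (j+1) := ev_syzygy _ _ _ hS (fun j => ev_pow (hev j) _)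
    refine ⟨?_, fun j => ev_mid s q hs hq hsq (ev_pow (hev j) _) (hSev j)⟩
    let z : Fin (a i) := ⟨0, ha i⟩
    obtain ⟨ψ, hψ⟩ := ev_extend s q hs hq hsq (hSev 0)
      (p ∘ₗ (LinearMap.proj z : (Fin (a i) → K i.castSucc) →ₗ[R] K i.castSucc))
    refine ⟨s ∘ₗ LinearMap.single R (fun _ : Fin (a i) => (K i.castSucc : Type u)) z ∘ₗ f, ψ, ?_⟩
    ext x
    have h1 := LinearMap.congr_fun hψ
      (LinearMap.single R (fun _ : Fin (a i) => (K i.castSucc : Type u)) z (f x))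
    refine h1.trans ?_
    have h2 : p (f x) = x := LinearMap.congr_fun hpf x
    refine Eq.trans ?_ h2
    change p (Pi.single (M := fun _ : Fin (a i) => (K i.castSucc : Type u)) z (f x) z) = p (f x)
    rw [Pi.single_eq_same]

end Helpers

theorem finiteGdim_of_finiteRedGdim_of_self_ext_vanishing
    (R : Type u) [CommRing R] [IsNoetherianRing R] [IsLocalRing R]
    (M : ModuleCat.{u} R) (hM : Module.Finite R M)
    (hred : FiniteRedGdim R M)
    (hext : ∀ i : ℕ, 1 ≤ i → ExtVanishes R M M i) :
    FiniteGdim R M ∧ ∃ i₀ : ℕ, ∀ i : ℕ, i₀ ≤ i → ExtVanishes R M (ModuleCat.of R R) i := by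
  obtain ⟨r, K, rfl, hK, m, hm⟩ := hred
  have h0 : ∀ j, EV (K 0) (K 0) (j+1) := fun j => (ev_iff _ _ _).1 (hext (j+1) (by omega))
  obtain ⟨⟨f, p, hpf⟩, -⟩ := summand_of_redSeq K hK h0 (Fin.last r)
  have hM' : RT m (K 0) := rt_retract m hM (hK.1 _) f p hpf ((rt_iff _ _).1 hm)
  refine ⟨⟨m, (rt_iff _ _).2 hM'⟩, m + 1, fun i hi => ?_⟩
  obtain ⟨k, rfl⟩ := Nat.exists_eq_add_of_le' hi
  exact (ev_iff _ _ (k + m)).2 (rt_ev m hM' k)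
end
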